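/- Let T be a compactly generated triangulated category with a single compact generator G such that Hom(G, Σ^nG) = 0 for all n ≫ 0, equipped with the generating sequence 𝒢 given by 𝒢^n = {Σ^{-n}G}. Then for every admissible subcategory A of T^c, the subcategory Coprod(A) ∩ T^b_c is a right admissible subcategory of T^b_c, where T^b_c = T̄^c ∩ 𝒢^⊥ is computed with respect to 𝒢 and the associated orthogonal metric R^𝒢. In particular, for a semiorthogonal decomposition ⟨A,B⟩ of T^c with B admissible, ⟨Coprod(A) ∩ T^b_c, Coprod(B) ∩ T^b_c⟩ is a semiorthogonal decomposition of T^b_c. -/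

import Mathlib

open CategoryTheory Limits Pretriangulated

universe v u

namespace Paper

variable (C : Type u) [Category.{v} C] [HasZeroObject C] [Preadditive C]
  [HasShift C ℤ] [∀ n : ℤ, (CategoryTheory.shiftFunctor C n).Additive] [Pretriangulated C]

variable {C}

/-- The right orthogonal of a class of objects. -/
def rOrth (S : Set C) : Set C := {X | ∀ ⦃A : C⦄, A ∈ S → ∀ f : A ⟶ X, f = 0}

/-- The left orthogonal of a class of objects. -/
def lOrth (S : Set C) : Set C := {X | ∀ ⦃A : C⦄, A ∈ S → ∀ f : X ⟶ A, f = 0}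

/-- `star S T` is the class of objects `Y` admitting a distinguished triangle
`A ⟶ Y ⟶ B ⟶ A⟦1⟧` with `A ∈ S` and `B ∈ T`. -/
def star (S T : Set C) : Set C :=
  {Y | ∃ (A B : C) (_ : A ∈ S) (_ : B ∈ T) (f : A ⟶ Y) (g : Y ⟶ B) (h : B ⟶ A⟦(1 : ℤ)⟧),
    Triangle.mk f g h ∈ distTriang C}

/-- The closure of a class of objects under finite coproducts and extensions
(equivalently, the smallest class containing `S` and all zero objects which is closed
under extensions). -/
inductive coprodClosure (S : Set C) : C → Prop
  | of {X : C} (hX : X ∈ S) : coprodClosure S X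
  | zero {X : C} (hX : IsZero X) : coprodClosure S X
  | ext {T : Triangle C} (hT : T ∈ distTriang C)
      (h₁ : coprodClosure S T.obj₁) (h₃ : coprodClosure S T.obj₃) : coprodClosure S T.obj₂

/-- The closure of a class of objects under direct summands (retracts). -/
def smd (S : Set C) : Set C :=
  {X | ∃ (Y : C) (_ : Y ∈ S) (i : X ⟶ Y) (r : Y ⟶ X), i ≫ r = 𝟙 X}

/-- The objects isomorphic to `Σ^{-i} G = G⟦-i⟧` for some `i ∈ I`. -/
def shiftSet (G : C) (I : Set ℤ) : Set C := {X | ∃ i ∈ I, Nonempty (X ≅ G⟦(-i : ℤ)⟧)}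

/-- `⟨G⟩^{I}` : summands of finite extensions of the shifts `Σ^{-i}G`, `i ∈ I`. -/
def genInt (G : C) (I : Set ℤ) : Set C := smd (setOf (coprodClosure (shiftSet G I)))

/-- The thick subcategory `⟨G⟩ = ∪_n ⟨G⟩^{[-n,n]}` generated by `G`. -/
def thickGen (G : C) : Set C := ⋃ n : ℕ, genInt G (Set.Icc (-(n : ℤ)) (n : ℤ))

/-- The closure of the union of a sequence of classes under finite coproducts, extensions
and direct summands; `𝒢^{I}` in the paper. -/
def seqInt (𝒢 : ℤ → Set C) (I : Set ℤ) : Set C :=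
  smd (setOf (coprodClosure (⋃ i ∈ I, 𝒢 i)))

section Coproducts

variable [HasCoproducts.{v} C]

/-- An object `G` is compact if every morphism from `G` to a coproduct factors through
a finite subcoproduct. -/
def IsCompactObj (G : C) : Prop :=
  ∀ ⦃α : Type v⦄ (f : α → C) (φ : G ⟶ ∐ f),
    ∃ (s : Finset α) (ψ : G ⟶ ∐ (fun i : s => f i)),
      φ = ψ ≫ Sigma.desc (fun i => Sigma.ι f i.1)

/-- The class of compact objects, `T^c`. -/
def compacts : Set C := {X | IsCompactObj X}

/-- `G` is a single compact generator of `T`. -/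
structure IsSingleCompactGenerator (G : C) : Prop where
  compact : IsCompactObj G
  generates : ∀ X : C, (∀ n : ℤ, ∀ f : G⟦n⟧ ⟶ X, f = 0) → IsZero X

/-- The closure of a class of objects under arbitrary (small) coproducts and extensions. -/
inductive bigClosure (S : Set C) : C → Prop
  | of {X : C} (hX : X ∈ S) : bigClosure S X
  | zero {X : C} (hX : IsZero X) : bigClosure S X
  | coprod {α : Type v} (f : α → C) (hf : ∀ a, bigClosure S (f a)) : bigClosure S (∐ f)
  | ext {T : Triangle C} (hT : T ∈ distTriang C)
      (h₁ : bigClosure S T.obj₁) (h₃ : bigClosure S T.obj₃) : bigClosure S T.obj₂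

/-- `Coprod(S)`, the closure of `S` under arbitrary coproducts and extensions. -/
def CoprodSet (S : Set C) : Set C := setOf (bigClosure S)

/-- `⟨G⟩̄^{I}` : summands of objects obtained from the shifts `Σ^{-i}G`, `i ∈ I`,
by arbitrary coproducts and extensions. -/
def genIntBig (G : C) (I : Set ℤ) : Set C := smd (CoprodSet (shiftSet G I))

end Coproducts

/-- A (strictly full) triangulated subcategory, as a class of objects. -/
structure IsTriangSub (S : Set C) : Prop where
  zero : ∀ X : C, IsZero X → X ∈ S
  isoClosed : ∀ {X Y : C}, (X ≅ Y) → X ∈ S → Y ∈ S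
  shift : ∀ X ∈ S, ∀ n : ℤ, X⟦n⟧ ∈ S
  ext : ∀ T ∈ distTriang C, T.obj₁ ∈ S → T.obj₃ ∈ S → T.obj₂ ∈ S

/-- The smallest strictly full triangulated subcategory containing `S`. -/
inductive triangClosure (S : Set C) : C → Prop
  | of {X : C} (hX : X ∈ S) : triangClosure S X
  | zero {X : C} (hX : IsZero X) : triangClosure S X
  | shift {X : C} (n : ℤ) (hX : triangClosure S X) : triangClosure S (X⟦n⟧)
  | ext {T : Triangle C} (hT : T ∈ distTriang C)
      (h₁ : triangClosure S T.obj₁) (h₃ : triangClosure S T.obj₃) : triangClosure S T.obj₂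

/-- A semiorthogonal decomposition `⟨A, B⟩` of the (triangulated) subcategory `D`:
`A` and `B` are strictly full triangulated subcategories of `D`, there are no nonzero
morphisms from objects of `B` to objects of `A`, and together they generate `D`. -/
structure IsSOD (D A B : Set C) : Prop where
  subsetA : A ⊆ D
  subsetB : B ⊆ D
  triangA : IsTriangSub A
  triangB : IsTriangSub B
  hom_zero : ∀ b ∈ B, ∀ a ∈ A, ∀ f : b ⟶ a, f = 0
  generates : setOf (triangClosure (A ∪ B)) = D

end Paper

namespace Paper

variable {C : Type u} [Category.{v} C] [HasZeroObject C] [Preadditive C]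
  [HasShift C ℤ] [∀ n : ℤ, (CategoryTheory.shiftFunctor C n).Additive] [Pretriangulated C]

/-- An extended good metric on a triangulated category. -/
structure IsGoodMetric (M : ℤ → Set C) : Prop where
  zero : ∀ n : ℤ, ∀ X : C, IsZero X → X ∈ M n
  isoClosed : ∀ n : ℤ, ∀ {X Y : C}, (X ≅ Y) → X ∈ M n → Y ∈ M n
  antitone : ∀ n : ℤ, M (n + 1) ⊆ M n
  extClosed : ∀ n : ℤ, star (M n) (M n) ⊆ M n
  shiftDown : ∀ n : ℤ, ∀ X ∈ M (n + 1), X⟦(-1 : ℤ)⟧ ∈ M n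
  shiftUp : ∀ n : ℤ, ∀ X ∈ M (n + 1), X⟦(1 : ℤ)⟧ ∈ M n

/-- A good metric is orthogonal if `^⊥((M_n)^⊥) = M_n` for all `n`. -/
def IsOrthogonalMetric (M : ℤ → Set C) : Prop :=
  IsGoodMetric M ∧ ∀ n : ℤ, lOrth (rOrth (M n)) = M n

section Coproducts

variable [HasCoproducts.{v} C]

/-- A generating sequence on a compactly generated triangulated category. -/
structure IsGenSeq (𝒢 : ℤ → Set C) : Prop where
  subset_compacts : ∀ n : ℤ, 𝒢 n ⊆ compacts
  generates : seqInt 𝒢 Set.univ = compacts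
  mem : ∀ n : ℤ, ∀ X ∈ 𝒢 n, X ∈ seqInt 𝒢 (Set.Icc (n - 1) (n + 1))
  shiftUp : ∀ n : ℤ, ∀ X ∈ 𝒢 n, X⟦(1 : ℤ)⟧ ∈ seqInt 𝒢 (Set.Icc (n - 1) (n + 1))
  shiftDown : ∀ n : ℤ, ∀ X ∈ 𝒢 n, X⟦(-1 : ℤ)⟧ ∈ seqInt 𝒢 (Set.Icc (n - 1) (n + 1))

/-- The closure of the compacts `T̄^c = ∩_{n∈ℤ} (T^c ⋆ R_n)` with respect to a metric `R`. -/
def closureCompacts (R : ℤ → Set C) : Set C :=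
  {F | ∀ n : ℤ, F ∈ star (compacts (C := C)) (R n)}

end Coproducts

end Paper

namespace Paper

set_option linter.unusedSectionVars false

variable {C : Type u} [Category.{v} C] [HasZeroObject C] [Preadditive C]
  [HasShift C ℤ] [∀ n : ℤ, (CategoryTheory.shiftFunctor C n).Additive] [Pretriangulated C]

section HomZero

/-- All morphisms from `X` to `Y` vanish. -/
def HomZero (X Y : C) : Prop := ∀ f : X ⟶ Y, f = 0

lemma HomZero.of_iso {X X' Y Y' : C} (h : HomZero X Y) (e : X ≅ X') (e' : Y ≅ Y') :
    HomZero X' Y' := fun f => by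
  have := h (e.hom ≫ f ≫ e'.inv)
  rw [← cancel_epi e.hom, ← cancel_mono e'.inv]
  simpa using this

lemma homZero_shift_iff (X Y : C) (n : ℤ) : HomZero (X⟦n⟧) (Y⟦n⟧) ↔ HomZero X Y := by
  constructor
  · intro h f
    exact (shiftFunctor C n).map_injective (by rw [h (f⟦n⟧'), Functor.map_zero])
  · intro h f
    obtain ⟨g, rfl⟩ := (shiftFunctor C n).map_surjective f
    rw [h g, Functor.map_zero]

/-- The canonical isomorphism `X⟦a⟧⟦b⟧ ≅ X⟦c⟧` for `a + b = c`. -/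
noncomputable def shiftShiftIso (X : C) (a b c : ℤ) (h : a + b = c) : X⟦a⟧⟦b⟧ ≅ X⟦c⟧ :=
  ((shiftFunctorAdd' C a b c h).app X).symm

/-- The canonical isomorphism `X⟦a⟧⟦b⟧ ≅ X` for `a + b = 0`. -/
noncomputable def shiftShiftIsoSelf (X : C) (a b : ℤ) (h : a + b = 0) : X⟦a⟧⟦b⟧ ≅ X :=
  (shiftFunctorCompIsoId C a b h).app X

lemma homZero_shift_left_iff (X Y : C) (n m : ℤ) (h : n + m = 0) :
    HomZero (X⟦n⟧) Y ↔ HomZero X (Y⟦m⟧) := by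
  rw [← homZero_shift_iff (X⟦n⟧) Y m]
  exact ⟨fun H => H.of_iso (shiftShiftIsoSelf X n m h) (Iso.refl _),
    fun H => H.of_iso (shiftShiftIsoSelf X n m h).symm (Iso.refl _)⟩

lemma HomZero.of_isZero_left {X Y : C} (h : IsZero X) : HomZero X Y := fun f => h.eq_of_src f 0

lemma HomZero.of_isZero_right {X Y : C} (h : IsZero Y) : HomZero X Y := fun f => h.eq_of_tgt f 0

lemma HomZero.ext_left {T : Triangle C} (hT : T ∈ distTriang C) {Y : C}
    (h₁ : HomZero T.obj₁ Y) (h₃ : HomZero T.obj₃ Y) : HomZero T.obj₂ Y := fun f => by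
  obtain ⟨g, rfl⟩ := T.yoneda_exact₂ hT f (h₁ _)
  rw [h₃ g, comp_zero]

lemma HomZero.ext_right {T : Triangle C} (hT : T ∈ distTriang C) {X : C}
    (h₁ : HomZero X T.obj₁) (h₃ : HomZero X T.obj₃) : HomZero X T.obj₂ := fun f => by
  obtain ⟨g, rfl⟩ := T.coyoneda_exact₂ hT f (h₃ _)
  rw [h₁ g, zero_comp]

lemma HomZero.retract_left {X X' Y : C} (h : HomZero X Y) (i : X' ⟶ X) (r : X ⟶ X')
    (hir : i ≫ r = 𝟙 X') : HomZero X' Y := fun f => by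
  rw [← Category.id_comp f, ← hir, Category.assoc, h (r ≫ f), comp_zero]

lemma HomZero.retract_right {X Y Y' : C} (h : HomZero X Y) (i : Y' ⟶ Y) (r : Y ⟶ Y')
    (hir : i ≫ r = 𝟙 Y') : HomZero X Y' := fun f => by
  rw [← Category.comp_id f, ← hir, ← Category.assoc, h (f ≫ i), zero_comp]

end HomZero

section FiveLemma

/-- Postcomposition with `φ` is bijective on morphisms out of `W`. -/
def CovBij (W : C) {X Y : C} (φ : X ⟶ Y) : Prop :=
  Function.Bijective (fun g : W ⟶ X => g ≫ φ)

/-- Precomposition with `φ` is bijective on morphisms into `W`. -/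
def ContraBij (W : C) {X Y : C} (φ : X ⟶ Y) : Prop :=
  Function.Bijective (fun g : Y ⟶ W => φ ≫ g)

lemma CovBij.eq_zero {W X Y : C} {φ : X ⟶ Y} (h : CovBij W φ) (g : W ⟶ X) (hg : g ≫ φ = 0) :
    g = 0 := h.1 (by simpa using hg)

lemma CovBij.exists_lift {W X Y : C} {φ : X ⟶ Y} (h : CovBij W φ) (g : W ⟶ Y) :
    ∃ g', g' ≫ φ = g := h.2 g

lemma ContraBij.eq_zero {W X Y : C} {φ : X ⟶ Y} (h : ContraBij W φ) (g : Y ⟶ W)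
    (hg : φ ≫ g = 0) : g = 0 := h.1 (by simpa using hg)

lemma ContraBij.exists_lift {W X Y : C} {φ : X ⟶ Y} (h : ContraBij W φ) (g : X ⟶ W) :
    ∃ g', φ ≫ g' = g := h.2 g

lemma covBij_of {W X Y : C} {φ : X ⟶ Y} (h₁ : ∀ g : W ⟶ X, g ≫ φ = 0 → g = 0)
    (h₂ : ∀ g : W ⟶ Y, ∃ g', g' ≫ φ = g) : CovBij W φ :=
  ⟨fun a b hab => sub_eq_zero.1 (h₁ _ (by simpa [sub_eq_zero] using hab)), h₂⟩

lemma contraBij_of {W X Y : C} {φ : X ⟶ Y} (h₁ : ∀ g : Y ⟶ W, φ ≫ g = 0 → g = 0)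
    (h₂ : ∀ g : X ⟶ W, ∃ g', φ ≫ g' = g) : ContraBij W φ :=
  ⟨fun a b hab => sub_eq_zero.1 (h₁ _ (by simpa [sub_eq_zero] using hab)), h₂⟩

lemma CovBij.of_iso {W W' X Y : C} {φ : X ⟶ Y} (h : CovBij W φ) (e : W ≅ W') : CovBij W' φ :=
  covBij_of
    (fun g hg => by
      have := h.eq_zero (e.hom ≫ g) (by simp [hg])
      simpa using this)
    (fun g => by
      obtain ⟨g', hg'⟩ := h.exists_lift (e.hom ≫ g)
      exact ⟨e.inv ≫ g', by simp [hg']⟩)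

lemma ContraBij.of_iso {W W' X Y : C} {φ : X ⟶ Y} (h : ContraBij W φ) (e : W ≅ W') :
    ContraBij W' φ :=
  contraBij_of
    (fun g hg => by
      have := h.eq_zero (g ≫ e.inv) (by simp [reassoc_of% hg])
      simpa using this)
    (fun g => by
      obtain ⟨g', hg'⟩ := h.exists_lift (g ≫ e.inv)
      exact ⟨g' ≫ e.hom, by simp [reassoc_of% hg']⟩)

lemma CovBij.shift {W X Y : C} {φ : X ⟶ Y} (h : CovBij W φ) (n : ℤ) :
    CovBij (W⟦n⟧) (φ⟦n⟧') :=
  covBij_of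
    (fun g hg => by
      obtain ⟨g, rfl⟩ := (shiftFunctor C n).map_surjective g
      rw [← Functor.map_comp, Functor.map_eq_zero_iff] at hg
      rw [h.eq_zero g hg, Functor.map_zero])
    (fun g => by
      obtain ⟨g, rfl⟩ := (shiftFunctor C n).map_surjective g
      obtain ⟨g', rfl⟩ := h.exists_lift g
      exact ⟨g'⟦n⟧', by simp⟩)

lemma ContraBij.shift {W X Y : C} {φ : X ⟶ Y} (h : ContraBij W φ) (n : ℤ) :
    ContraBij (W⟦n⟧) (φ⟦n⟧') :=
  contraBij_of
    (fun g hg => by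
      obtain ⟨g, rfl⟩ := (shiftFunctor C n).map_surjective g
      rw [← Functor.map_comp, Functor.map_eq_zero_iff] at hg
      rw [h.eq_zero g hg, Functor.map_zero])
    (fun g => by
      obtain ⟨g, rfl⟩ := (shiftFunctor C n).map_surjective g
      obtain ⟨g', rfl⟩ := h.exists_lift g
      exact ⟨g'⟦n⟧', by simp⟩)

lemma CovBij.shift_map {W X Y : C} {φ : X ⟶ Y} (n m : ℤ) (hnm : m + n = 0)
    (h : CovBij (W⟦m⟧) φ) : CovBij W (φ⟦n⟧') :=
  (h.shift n).of_iso (shiftShiftIsoSelf W m n hnm)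

lemma ContraBij.shift_map {W X Y : C} {φ : X ⟶ Y} (n m : ℤ) (hnm : m + n = 0)
    (h : ContraBij (W⟦m⟧) φ) : ContraBij W (φ⟦n⟧') :=
  (h.shift n).of_iso (shiftShiftIsoSelf W m n hnm)

lemma yoneda_exact₁ {T : Triangle C} (hT : T ∈ distTriang C) {X : C} (f : T.obj₁ ⟶ X)
    (hf : T.mor₃ ≫ f⟦(1 : ℤ)⟧' = 0) : ∃ g : T.obj₂ ⟶ X, f = T.mor₁ ≫ g := by
  obtain ⟨l, hl⟩ : ∃ l : T.obj₂⟦(1 : ℤ)⟧ ⟶ X⟦(1 : ℤ)⟧, f⟦(1 : ℤ)⟧' = (-T.mor₁⟦(1 : ℤ)⟧') ≫ l :=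
    Triangle.yoneda_exact₃ _ (rot_of_distTriang _ hT) (f⟦(1 : ℤ)⟧') hf
  obtain ⟨l, rfl⟩ := (shiftFunctor C (1 : ℤ)).map_surjective l
  refine ⟨-l, (shiftFunctor C (1 : ℤ)).map_injective ?_⟩
  rw [hl]
  simp

/-- The covariant five lemma for a morphism of distinguished triangles. -/
lemma covBij₂ {T T' : Triangle C} (hT : T ∈ distTriang C) (hT' : T' ∈ distTriang C)
    (φ : T ⟶ T') {W : C} (h₁ : CovBij W φ.hom₁) (h₁' : CovBij (W⟦(-1 : ℤ)⟧) φ.hom₁)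
    (h₃ : CovBij W φ.hom₃) (h₃' : CovBij (W⟦(1 : ℤ)⟧) φ.hom₃) : CovBij W φ.hom₂ := by
  refine covBij_of (fun g hg => ?_) (fun g => ?_)
  · have hg₂ : g ≫ T.mor₂ = 0 := h₃.eq_zero _ (by
      rw [Category.assoc, φ.comm₂, reassoc_of% hg, zero_comp])
    obtain ⟨l, rfl⟩ := T.coyoneda_exact₂ hT g hg₂
    obtain ⟨m, hm⟩ := T'.coyoneda_exact₁ hT' ((l ≫ φ.hom₁)⟦(1 : ℤ)⟧') (by
      rw [← Functor.map_comp, Category.assoc, ← φ.comm₁, ← Category.assoc, hg, Functor.map_zero])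
    obtain ⟨m', rfl⟩ := h₃'.exists_lift m
    have hl : l⟦(1 : ℤ)⟧' = m' ≫ T.mor₃ := (h₁.shift 1).1 (by
      dsimp only
      rw [← Functor.map_comp, hm, Category.assoc, Category.assoc, φ.comm₃])
    apply (shiftFunctor C (1 : ℤ)).map_injective
    rw [Functor.map_comp, hl, Category.assoc, comp_distTriang_mor_zero₃₁ _ hT, comp_zero,
      Functor.map_zero]
  · obtain ⟨k, hk⟩ := h₃.exists_lift (g ≫ T'.mor₂)
    have hk₃ : k ≫ T.mor₃ = 0 := (h₁'.shift_map 1 (-1) (by simp)).eq_zero _ (by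
      rw [Category.assoc, φ.comm₃, reassoc_of% hk, comp_distTriang_mor_zero₂₃ _ hT', comp_zero])
    obtain ⟨l, rfl⟩ := T.coyoneda_exact₃ hT k hk₃
    obtain ⟨m, hm⟩ := T'.coyoneda_exact₂ hT' (g - l ≫ φ.hom₂) (by
      rw [Preadditive.sub_comp, Category.assoc, ← φ.comm₂, ← Category.assoc, hk, sub_self])
    obtain ⟨m', rfl⟩ := h₁.exists_lift m
    refine ⟨l + m' ≫ T.mor₁, ?_⟩
    rw [Preadditive.add_comp, Category.assoc, φ.comm₁, ← Category.assoc, ← hm]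
    abel

/-- The contravariant five lemma for a morphism of distinguished triangles. -/
lemma contraBij₂ {T T' : Triangle C} (hT : T ∈ distTriang C) (hT' : T' ∈ distTriang C)
    (φ : T ⟶ T') {W : C} (h₁ : ContraBij W φ.hom₁) (h₁' : ContraBij (W⟦(-1 : ℤ)⟧) φ.hom₁)
    (h₃ : ContraBij W φ.hom₃) (h₃' : ContraBij (W⟦(1 : ℤ)⟧) φ.hom₃) :
    ContraBij W φ.hom₂ := by
  refine contraBij_of (fun g hg => ?_) (fun g => ?_)
  · obtain ⟨k, rfl⟩ := T'.yoneda_exact₂ hT' g (h₁.eq_zero _ (by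
      rw [← Category.assoc, ← φ.comm₁, Category.assoc, hg, comp_zero]))
    obtain ⟨l, hl⟩ := T.yoneda_exact₃ hT (φ.hom₃ ≫ k) (by
      rw [← Category.assoc, φ.comm₂, Category.assoc, hg])
    obtain ⟨l', rfl⟩ := (h₁'.shift_map 1 (-1) (by simp)).exists_lift l
    have hk : k = T'.mor₃ ≫ l' := h₃.1 (by
      dsimp only
      rw [hl, ← Category.assoc, φ.comm₃, Category.assoc])
    rw [hk, ← Category.assoc, comp_distTriang_mor_zero₂₃ _ hT', zero_comp]
  · obtain ⟨k, hk⟩ := h₁.exists_lift (T.mor₁ ≫ g)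
    have hk₃ : T'.mor₃ ≫ k⟦(1 : ℤ)⟧' = 0 := h₃'.eq_zero _ (by
      rw [← Category.assoc, ← φ.comm₃, Category.assoc, ← Functor.map_comp, hk, Functor.map_comp,
        ← Category.assoc, comp_distTriang_mor_zero₃₁ _ hT, zero_comp])
    obtain ⟨l, rfl⟩ := yoneda_exact₁ hT' k hk₃
    obtain ⟨m, hm⟩ := T.yoneda_exact₂ hT (g - φ.hom₂ ≫ l) (by
      rw [Preadditive.comp_sub, ← hk, ← Category.assoc, ← Category.assoc, φ.comm₁, sub_self])
    obtain ⟨m', rfl⟩ := h₃.exists_lift m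
    refine ⟨l + T'.mor₂ ≫ m', ?_⟩
    rw [Preadditive.comp_add, ← Category.assoc, ← φ.comm₂, Category.assoc, ← hm]
    simp

lemma covBij_mor₁ {T : Triangle C} (hT : T ∈ distTriang C) {W : C}
    (h : HomZero W T.obj₃) (h' : HomZero (W⟦(1 : ℤ)⟧) T.obj₃) : CovBij W T.mor₁ := by
  refine covBij_of (fun g hg => ?_) (fun g => ?_)
  · obtain ⟨l, hl⟩ := T.coyoneda_exact₁ hT (g⟦(1 : ℤ)⟧') (by
      rw [← Functor.map_comp, hg, Functor.map_zero])
    apply (shiftFunctor C (1 : ℤ)).map_injective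
    rw [hl, h' l, zero_comp, Functor.map_zero]
  · obtain ⟨l, rfl⟩ := T.coyoneda_exact₂ hT g (h _)
    exact ⟨l, rfl⟩

lemma homZero_obj₃_of_covBij {T : Triangle C} (hT : T ∈ distTriang C) {W : C}
    (h : CovBij W T.mor₁) (h' : CovBij (W⟦(-1 : ℤ)⟧) T.mor₁) : HomZero W T.obj₃ := fun f => by
  obtain ⟨g, rfl⟩ := T.coyoneda_exact₃ hT f ((h'.shift_map 1 (-1) (by simp)).eq_zero _ (by
    rw [Category.assoc, comp_distTriang_mor_zero₃₁ _ hT, comp_zero]))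
  obtain ⟨g', rfl⟩ := h.exists_lift g
  rw [Category.assoc, comp_distTriang_mor_zero₁₂ _ hT, comp_zero]

lemma contraBij_mor₁ {T : Triangle C} (hT : T ∈ distTriang C) {W : C}
    (h : HomZero T.obj₃ W) (h' : HomZero T.obj₃ (W⟦(1 : ℤ)⟧)) : ContraBij W T.mor₁ := by
  refine contraBij_of (fun g hg => ?_) (fun g => ?_)
  · obtain ⟨l, rfl⟩ := T.yoneda_exact₂ hT g hg
    rw [h l, comp_zero]
  · obtain ⟨l, rfl⟩ := yoneda_exact₁ hT g (h' _)
    exact ⟨l, rfl⟩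

lemma homZero_obj₃_of_contraBij {T : Triangle C} (hT : T ∈ distTriang C) {W : C}
    (h : ContraBij W T.mor₁) (h' : ContraBij (W⟦(-1 : ℤ)⟧) T.mor₁) : HomZero T.obj₃ W :=
  fun f => by
  obtain ⟨g, rfl⟩ := T.yoneda_exact₃ hT f (h.eq_zero _ (by
    rw [← Category.assoc, comp_distTriang_mor_zero₁₂ _ hT, zero_comp]))
  obtain ⟨g', rfl⟩ := (h'.shift_map 1 (-1) (by simp)).exists_lift g
  rw [← Category.assoc, comp_distTriang_mor_zero₃₁ _ hT, zero_comp]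

end FiveLemma

section TriangSub

open scoped ZeroObject

lemma exists_dist_of_iso {X Y : C} (e : X ≅ Y) :
    ∃ (Z : C) (g : Y ⟶ Z) (h : Z ⟶ X⟦(1 : ℤ)⟧), IsZero Z ∧
      Triangle.mk e.hom g h ∈ distTriang C := by
  obtain ⟨Z, g, h, hT⟩ := distinguished_cocone_triangle e.hom
  exact ⟨Z, g, h, Triangle.isZero₃_of_isIso₁ _ hT (inferInstanceAs (IsIso e.hom)), hT⟩

namespace IsTriangSub

variable {S : Set C}

lemma obj₃_mem (hS : IsTriangSub S) {T : Triangle C} (hT : T ∈ distTriang C) (h₁ : T.obj₁ ∈ S)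
    (h₂ : T.obj₂ ∈ S) : T.obj₃ ∈ S :=
  hS.ext _ (rot_of_distTriang _ hT) h₂ (hS.shift _ h₁ 1)

lemma obj₁_mem (hS : IsTriangSub S) {T : Triangle C} (hT : T ∈ distTriang C) (h₂ : T.obj₂ ∈ S)
    (h₃ : T.obj₃ ∈ S) : T.obj₁ ∈ S :=
  hS.ext _ (inv_rot_of_distTriang _ hT) (hS.shift _ h₃ (-1)) h₂

lemma triangClosure_le (hS : IsTriangSub S) {S' : Set C} (h : S' ⊆ S) :
    setOf (triangClosure S') ⊆ S := by
  intro X hX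
  induction hX with
  | of hX => exact h hX
  | zero hX => exact hS.zero _ hX
  | shift n _ ih => exact hS.shift _ ih n
  | ext hT _ _ h₁ h₃ => exact hS.ext _ hT h₁ h₃

lemma inter (hS : IsTriangSub S) {S' : Set C} (hS' : IsTriangSub S') :
    IsTriangSub (S ∩ S') where
  zero X hX := ⟨hS.zero X hX, hS'.zero X hX⟩
  isoClosed e hX := ⟨hS.isoClosed e hX.1, hS'.isoClosed e hX.2⟩
  shift X hX n := ⟨hS.shift X hX.1 n, hS'.shift X hX.2 n⟩
  ext T hT h₁ h₃ := ⟨hS.ext T hT h₁.1 h₃.1, hS'.ext T hT h₁.2 h₃.2⟩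

lemma rOrth (hS : IsTriangSub S) : IsTriangSub (rOrth S) where
  zero _ hX _ _ := HomZero.of_isZero_right hX
  isoClosed e hX _ hA := HomZero.of_iso (hX hA) (Iso.refl _) e
  shift X hX n A hA :=
    (homZero_shift_left_iff A X (-n) n (by simp)).1 (hX (hS.shift A hA (-n)))
  ext _ hT h₁ h₃ _ hA := HomZero.ext_right hT (h₁ hA) (h₃ hA)

lemma lOrth (hS : IsTriangSub S) : IsTriangSub (lOrth S) where
  zero _ hX _ _ := HomZero.of_isZero_left hX
  isoClosed e hX _ hA := HomZero.of_iso (hX hA) e (Iso.refl _)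
  shift X hX n A hA :=
    (homZero_shift_left_iff X A n (-n) (by simp)).2 (hX (hS.shift A hA (-n)))
  ext _ hT h₁ h₃ _ hA := HomZero.ext_left hT (h₁ hA) (h₃ hA)

end IsTriangSub

/-- In a semiorthogonal decomposition `⟨A, B⟩`, every object has a coreflection in `B`. -/
lemma IsSOD.exists_coreflection {D A B : Set C} (h : IsSOD D A B) {X : C} (hX : X ∈ D) :
    ∃ (b y : C) (_ : b ∈ B) (_ : y ∈ rOrth B) (f : b ⟶ X) (g : X ⟶ y) (k : y ⟶ b⟦(1 : ℤ)⟧),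
      Triangle.mk f g k ∈ distTriang C := by
  suffices H : ∃ (b : C) (_ : b ∈ B) (f : b ⟶ X), ∀ w ∈ B, CovBij w f by
    obtain ⟨b, hb, f, hf⟩ := H
    obtain ⟨y, g, k, hT⟩ := distinguished_cocone_triangle f
    exact ⟨b, y, hb, fun w hw => homZero_obj₃_of_covBij hT (hf w hw)
      (hf _ (h.triangB.shift w hw _)), f, g, k, hT⟩
  rw [← h.generates] at hX
  have h_id : ∀ X ∈ B, ∃ (b : C) (_ : b ∈ B) (f : b ⟶ X), ∀ w ∈ B, CovBij w f := fun X hX =>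
    ⟨X, hX, 𝟙 X, fun w _ => covBij_of (by simp) (by simp)⟩
  induction hX with
  | @of X hX =>
    obtain hX | hX := hX
    · exact ⟨0, h.triangB.zero _ (isZero_zero C), 0, fun w hw =>
        covBij_of (fun g _ => (isZero_zero C).eq_of_tgt _ _)
          (fun g => ⟨0, by rw [h.hom_zero w hw X hX g, zero_comp]⟩)⟩
    · exact h_id X hX
  | zero hX => exact h_id _ (h.triangB.zero _ hX)
  | shift n _ ih =>
    obtain ⟨b, hb, f, hf⟩ := ih
    exact ⟨b⟦n⟧, h.triangB.shift b hb n, f⟦n⟧', fun w hw =>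
      (hf _ (h.triangB.shift w hw (-n))).shift_map n (-n) (by simp)⟩
  | @ext T hT _ _ ih₁ ih₃ =>
    obtain ⟨b₁, hb₁, f₁, hf₁⟩ := ih₁
    obtain ⟨b₃, hb₃, f₃, hf₃⟩ := ih₃
    obtain ⟨d, hd⟩ := ((hf₁ _ (h.triangB.shift b₃ hb₃ (-1))).shift_map 1 (-1)
      (by simp)).exists_lift (f₃ ≫ T.mor₃)
    obtain ⟨b₂, u, v, hb⟩ := distinguished_cocone_triangle₂ d
    obtain ⟨f₂, c₁, c₂⟩ := complete_distinguished_triangle_morphism₂ _ T hb hT f₁ f₃ hd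
    refine ⟨b₂, h.triangB.ext _ hb hb₁ hb₃, f₂, fun w hw => ?_⟩
    exact covBij₂ hb hT (Triangle.homMk _ _ f₁ f₂ f₃ c₁ c₂ hd) (hf₁ _ hw)
      (hf₁ _ (h.triangB.shift w hw _)) (hf₃ _ hw) (hf₃ _ (h.triangB.shift w hw _))

/-- In a semiorthogonal decomposition `⟨A, B⟩`, every object has a reflection in `A`. -/
lemma IsSOD.exists_reflection {D A B : Set C} (h : IsSOD D A B) {X : C} (hX : X ∈ D) :
    ∃ (y a : C) (_ : y ∈ lOrth A) (_ : a ∈ A) (f : y ⟶ X) (g : X ⟶ a) (k : a ⟶ y⟦(1 : ℤ)⟧),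
      Triangle.mk f g k ∈ distTriang C := by
  suffices H : ∃ (a : C) (_ : a ∈ A) (g : X ⟶ a), ∀ w ∈ A, ContraBij w g by
    obtain ⟨a, ha, g, hg⟩ := H
    obtain ⟨z, k, f, hT⟩ := distinguished_cocone_triangle g
    have hz : z ∈ lOrth A := fun w hw => homZero_obj₃_of_contraBij hT (hg w hw)
      (hg _ (h.triangA.shift w hw _))
    exact ⟨_, _, h.triangA.lOrth.shift z hz (-1), ha, _, _, _, inv_rot_of_distTriang _ hT⟩
  rw [← h.generates] at hX
  have h_id : ∀ X ∈ A, ∃ (a : C) (_ : a ∈ A) (g : X ⟶ a), ∀ w ∈ A, ContraBij w g := fun X hX =>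
    ⟨X, hX, 𝟙 X, fun w _ => contraBij_of (by simp) (by simp)⟩
  induction hX with
  | @of X hX =>
    obtain hX | hX := hX
    · exact h_id X hX
    · exact ⟨0, h.triangA.zero _ (isZero_zero C), 0, fun w hw =>
        contraBij_of (fun g _ => (isZero_zero C).eq_of_src _ _)
          (fun g => ⟨0, by rw [h.hom_zero X hX w hw g, comp_zero]⟩)⟩
  | zero hX => exact h_id _ (h.triangA.zero _ hX)
  | shift n _ ih =>
    obtain ⟨a, ha, g, hg⟩ := ih
    exact ⟨a⟦n⟧, h.triangA.shift a ha n, g⟦n⟧', fun w hw =>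
      (hg _ (h.triangA.shift w hw (-n))).shift_map n (-n) (by simp)⟩
  | @ext T hT _ _ ih₁ ih₃ =>
    obtain ⟨a₁, ha₁, g₁, hg₁⟩ := ih₁
    obtain ⟨a₃, ha₃, g₃, hg₃⟩ := ih₃
    obtain ⟨d, hd⟩ := (hg₃ _ (h.triangA.shift a₁ ha₁ 1)).exists_lift (T.mor₃ ≫ g₁⟦(1 : ℤ)⟧')
    obtain ⟨a₂, u, v, ha⟩ := distinguished_cocone_triangle₂ d
    obtain ⟨g₂, c₁, c₂⟩ := complete_distinguished_triangle_morphism₂ T _ hT ha g₁ g₃ hd.symm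
    refine ⟨a₂, h.triangA.ext _ ha ha₁ ha₃, g₂, fun w hw => ?_⟩
    exact contraBij₂ hT ha (Triangle.homMk _ _ g₁ g₂ g₃ c₁ c₂ hd.symm) (hg₁ _ hw)
      (hg₁ _ (h.triangA.shift w hw _)) (hg₃ _ hw) (hg₃ _ (h.triangA.shift w hw _))

end TriangSub

end Paper

namespace Paper

set_option linter.unusedSectionVars false

variable {C : Type u} [Category.{v} C] [HasZeroObject C] [Preadditive C]
  [HasShift C ℤ] [∀ n : ℤ, (CategoryTheory.shiftFunctor C n).Additive] [Pretriangulated C]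
  [HasCoproducts.{v} C]

section Compact

open Classical in
/-- The projection from a coproduct to one of its summands. -/
noncomputable def sigmaProj {α : Type v} (f : α → C) (i : α) : ∐ f ⟶ f i := Sigma.π f i

@[simp]
lemma ι_sigmaProj_self {α : Type v} (f : α → C) (i : α) :
    Sigma.ι f i ≫ sigmaProj f i = 𝟙 (f i) := by
  classical
  exact Sigma.ι_π_eq_id f i

lemma ι_sigmaProj_of_ne {α : Type v} (f : α → C) {i j : α} (h : i ≠ j) :
    Sigma.ι f i ≫ sigmaProj f j = 0 := by
  classical
  exact Sigma.ι_π_of_ne f h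

lemma sum_ι_sigmaProj_ι {α : Type v} (f : α → C) (s : Finset α) {i : α} (hi : i ∈ s) :
    ∑ k ∈ s, Sigma.ι f i ≫ sigmaProj f k ≫ Sigma.ι f k = Sigma.ι f i := by
  rw [Finset.sum_eq_single i]
  · rw [← Category.assoc, ι_sigmaProj_self, Category.id_comp]
  · intro b _ hb
    rw [← Category.assoc, ι_sigmaProj_of_ne f hb.symm, zero_comp]
  · exact fun h => (h hi).elim

lemma IsCompactObj.exists_eq_sum {p : C} (hp : IsCompactObj p) {α : Type v} (f : α → C)
    (φ : p ⟶ ∐ f) : ∃ s : Finset α, φ = ∑ i ∈ s, (φ ≫ sigmaProj f i) ≫ Sigma.ι f i := by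
  obtain ⟨s, ψ, rfl⟩ := hp f φ
  refine ⟨s, ?_⟩
  simp only [Category.assoc]
  rw [← Preadditive.comp_sum]
  congr 1
  refine Sigma.hom_ext _ _ fun i => ?_
  rw [Preadditive.comp_sum]
  simp only [Sigma.ι_desc, Sigma.ι_desc_assoc]
  exact (sum_ι_sigmaProj_ι f s i.2).symm

lemma isCompactObj_of_exists_eq_sum {p : C}
    (h : ∀ ⦃α : Type v⦄ (f : α → C) (φ : p ⟶ ∐ f),
      ∃ (s : Finset α) (g : ∀ i, p ⟶ f i), φ = ∑ i ∈ s, g i ≫ Sigma.ι f i) :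
    IsCompactObj p := fun α f φ => by
  obtain ⟨s, g, rfl⟩ := h f φ
  refine ⟨s, ∑ i ∈ s.attach, g i.1 ≫ Sigma.ι (fun i : s => f i) i, ?_⟩
  rw [Preadditive.sum_comp]
  simp only [Category.assoc, Sigma.ι_desc]
  exact (Finset.sum_attach s (fun i => g i ≫ Sigma.ι f i)).symm

/-- The shift commutes with coproducts. -/
noncomputable def shiftSigmaIso {α : Type v} (f : α → C) (n : ℤ) :
    (∐ f)⟦n⟧ ≅ ∐ fun i => (f i)⟦n⟧ :=
  PreservesCoproduct.iso (shiftFunctor C n) f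

lemma ι_shiftSigmaIso_inv {α : Type v} (f : α → C) (n : ℤ) (i : α) :
    Sigma.ι (fun i => (f i)⟦n⟧) i ≫ (shiftSigmaIso f n).inv = (Sigma.ι f i)⟦n⟧' :=
  ι_comp_sigmaComparison (shiftFunctor C n) f i

lemma IsCompactObj.of_iso {p q : C} (hp : IsCompactObj p) (e : p ≅ q) : IsCompactObj q :=
  fun α f φ => by
  obtain ⟨s, ψ, h⟩ := hp f (e.hom ≫ φ)
  exact ⟨s, e.inv ≫ ψ, by rw [Category.assoc, ← h, Iso.inv_hom_id_assoc]⟩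

lemma IsCompactObj.shift {p : C} (hp : IsCompactObj p) (n : ℤ) : IsCompactObj (p⟦n⟧) := by
  refine isCompactObj_of_exists_eq_sum fun α f φ => ?_
  obtain ⟨s, h⟩ := (hp.of_iso (shiftShiftIsoSelf p n (-n) (by simp)).symm).exists_eq_sum _
    (φ⟦-n⟧' ≫ (shiftSigmaIso f (-n)).hom)
  choose g hg using fun i => (shiftFunctor C (-n)).map_surjective
    ((φ⟦-n⟧' ≫ (shiftSigmaIso f (-n)).hom) ≫ sigmaProj (fun i => (f i)⟦-n⟧) i)
  refine ⟨s, g, (shiftFunctor C (-n)).map_injective ?_⟩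
  rw [← cancel_mono (shiftSigmaIso f (-n)).hom, h, Functor.map_sum, Preadditive.sum_comp]
  refine Finset.sum_congr rfl fun i _ => ?_
  rw [Functor.map_comp, hg, ← ι_shiftSigmaIso_inv]
  simp only [Category.assoc, Iso.inv_hom_id, Category.comp_id]

lemma IsCompactObj.ext {T : Triangle C} (hT : T ∈ distTriang C) (h₁ : IsCompactObj T.obj₁)
    (h₃ : IsCompactObj T.obj₃) : IsCompactObj T.obj₂ := by
  classical
  refine isCompactObj_of_exists_eq_sum fun α f φ => ?_
  obtain ⟨s, hs⟩ := h₁.exists_eq_sum f (T.mor₁ ≫ φ)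
  obtain ⟨ψ, hψ⟩ := T.yoneda_exact₂ hT (φ - ∑ i ∈ s, (φ ≫ sigmaProj f i) ≫ Sigma.ι f i) (by
    rw [Preadditive.comp_sub, hs, Preadditive.comp_sum]
    simp)
  obtain ⟨t, ht⟩ := h₃.exists_eq_sum f ψ
  refine ⟨s ∪ t, fun i => (if i ∈ s then φ ≫ sigmaProj f i else 0) +
    (if i ∈ t then T.mor₂ ≫ ψ ≫ sigmaProj f i else 0), ?_⟩
  have hφ : φ = ∑ i ∈ s, (φ ≫ sigmaProj f i) ≫ Sigma.ι f i +
      ∑ i ∈ t, (T.mor₂ ≫ ψ ≫ sigmaProj f i) ≫ Sigma.ι f i := by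
    refine (sub_eq_iff_eq_add'.1 hψ).trans (congrArg _ ?_)
    conv_lhs => rw [ht, Preadditive.comp_sum]
    simp only [Category.assoc]
  refine hφ.trans ?_
  simp only [Preadditive.add_comp, Finset.sum_add_distrib, ite_comp, zero_comp,
    Finset.sum_ite_mem, Finset.union_inter_cancel_left, Finset.union_inter_cancel_right]

lemma isTriangSub_compacts : IsTriangSub (compacts (C := C)) where
  zero _ hX _ _ _ := ⟨∅, 0, hX.eq_of_src _ _⟩
  isoClosed e hX := hX.of_iso e
  shift _ hX n := hX.shift n
  ext _ hT h₁ h₃ := IsCompactObj.ext hT h₁ h₃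

lemma IsCompactObj.eq_zero {p : C} (hp : IsCompactObj p) {α : Type v} (f : α → C)
    (φ : p ⟶ ∐ f) (h : ∀ i, φ ≫ sigmaProj f i = 0) : φ = 0 := by
  obtain ⟨s, hs⟩ := hp.exists_eq_sum f φ
  rw [hs]
  simp [h]

end Compact

section BigClosure

lemma bigClosure.of_iso {S : Set C} {X Y : C} (h : bigClosure S X) (e : X ≅ Y) :
    bigClosure S Y := by
  obtain ⟨Z, g, k, hZ, hT⟩ := exists_dist_of_iso e
  exact .ext hT h (.zero hZ)

lemma bigClosure.le {S S' : Set C} (h : ∀ X ∈ S, bigClosure S' X) {X : C}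
    (hX : bigClosure S X) : bigClosure S' X := by
  induction hX with
  | of hX => exact h _ hX
  | zero hX => exact .zero hX
  | coprod f _ ih => exact .coprod f ih
  | ext hT _ _ h₁ h₃ => exact .ext hT h₁ h₃

lemma bigClosure.shift {S S' : Set C} {n : ℤ} (h : ∀ X ∈ S, bigClosure S' (X⟦n⟧)) {X : C}
    (hX : bigClosure S X) : bigClosure S' (X⟦n⟧) := by
  induction hX with
  | of hX => exact h _ hX
  | zero hX => exact .zero ((shiftFunctor C n).map_isZero hX)
  | coprod f _ ih => exact (bigClosure.coprod _ ih).of_iso (shiftSigmaIso f n).symm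
  | ext hT _ _ h₁ h₃ => exact .ext (Triangle.shift_distinguished _ hT n) h₁ h₃

lemma isTriangSub_coprodSet {S : Set C} (hS : IsTriangSub S) : IsTriangSub (CoprodSet S) where
  zero _ hX := .zero hX
  isoClosed e hX := bigClosure.of_iso hX e
  shift _ hX n := bigClosure.shift (fun X hX => .of (hS.shift X hX n)) hX
  ext _ hT h₁ h₃ := .ext hT h₁ h₃

lemma bigClosure.homZero {S : Set C} {X Y : C} (hX : bigClosure S X)
    (h : ∀ s ∈ S, HomZero s Y) : HomZero X Y := by
  induction hX with
  | of hX => exact h _ hX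
  | zero hX => exact .of_isZero_left hX
  | coprod f _ ih => exact fun g => Sigma.hom_ext _ _ fun i => (ih i _).trans comp_zero.symm
  | ext hT _ _ h₁ h₃ => exact .ext_left hT h₁ h₃

lemma IsCompactObj.homZero_of_bigClosure {p : C} (hp : IsCompactObj p) {S : Set C}
    (h : ∀ s ∈ S, HomZero p s) {X : C} (hX : bigClosure S X) : HomZero p X := by
  induction hX with
  | of hX => exact h _ hX
  | zero hX => exact .of_isZero_right hX
  | coprod f _ ih => exact fun g => hp.eq_zero f g fun i => ih i _
  | ext hT _ _ h₁ h₃ => exact .ext_right hT h₁ h₃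

end BigClosure

section UnbundledTriangles

variable {X Y Z : C} {f : X ⟶ Y} {g : Y ⟶ Z} {h : Z ⟶ X⟦(1 : ℤ)⟧}

lemma dist_comp₁₂ (hT : Triangle.mk f g h ∈ distTriang C) : f ≫ g = 0 :=
  comp_distTriang_mor_zero₁₂ _ hT

lemma dist_comp₂₃ (hT : Triangle.mk f g h ∈ distTriang C) : g ≫ h = 0 :=
  comp_distTriang_mor_zero₂₃ _ hT

lemma dist_comp₃₁ (hT : Triangle.mk f g h ∈ distTriang C) : h ≫ f⟦(1 : ℤ)⟧' = 0 :=
  comp_distTriang_mor_zero₃₁ _ hT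

lemma dist_lift₂ (hT : Triangle.mk f g h ∈ distTriang C) {W : C} (φ : W ⟶ Y) (hφ : φ ≫ g = 0) :
    ∃ ψ : W ⟶ X, ψ ≫ f = φ := by
  obtain ⟨ψ, hψ⟩ := Triangle.coyoneda_exact₂ _ hT φ hφ
  exact ⟨ψ, hψ.symm⟩

lemma dist_lift₃ (hT : Triangle.mk f g h ∈ distTriang C) {W : C} (φ : W ⟶ Z) (hφ : φ ≫ h = 0) :
    ∃ ψ : W ⟶ Y, ψ ≫ g = φ := by
  obtain ⟨ψ, hψ⟩ := Triangle.coyoneda_exact₃ _ hT φ hφ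
  exact ⟨ψ, hψ.symm⟩

lemma dist_desc₂ (hT : Triangle.mk f g h ∈ distTriang C) {W : C} (φ : Y ⟶ W) (hφ : f ≫ φ = 0) :
    ∃ ψ : Z ⟶ W, g ≫ ψ = φ := by
  obtain ⟨ψ, hψ⟩ := Triangle.yoneda_exact₂ _ hT φ hφ
  exact ⟨ψ, hψ.symm⟩

end UnbundledTriangles

section Telescope

lemma eq_zero_of_comp_shift_eq_zero {W X Y : C} {φ : X ⟶ Y}
    (h : ∀ g : W⟦(-1 : ℤ)⟧ ⟶ X, g ≫ φ = 0 → g = 0) (g : W ⟶ X⟦(1 : ℤ)⟧)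
    (hg : g ≫ φ⟦(1 : ℤ)⟧' = 0) : g = 0 := by
  let e := shiftShiftIsoSelf W (-1) 1 (by simp)
  obtain ⟨g', hg'⟩ := (shiftFunctor C (1 : ℤ)).map_surjective (e.hom ≫ g)
  have : g' = 0 := h g' ((shiftFunctor C (1 : ℤ)).map_injective (by
    rw [Functor.map_comp, hg', Category.assoc, hg, comp_zero, Functor.map_zero]))
  rw [← cancel_epi e.hom, ← hg', this, Functor.map_zero, comp_zero]

variable (a : ℕ → C) (t : ∀ k, a k ⟶ a (k + 1))

/-- The coproduct of a sequence of objects. -/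
noncomputable abbrev seqSigma : C := ∐ fun k : ULift.{v} ℕ => a k.down

/-- The inclusion of a term into the coproduct of a sequence. -/
noncomputable abbrev seqι (k : ℕ) : a k ⟶ seqSigma a :=
  Sigma.ι (fun k : ULift.{v} ℕ => a k.down) ⟨k⟩

/-- The map `1 - shift` on the coproduct of a sequence. -/
noncomputable def telescopeMap : seqSigma a ⟶ seqSigma a :=
  Sigma.desc fun k => seqι a k.down - t k.down ≫ seqι a (k.down + 1)

lemma seqι_telescopeMap (k : ℕ) :
    seqι a k ≫ telescopeMap a t = seqι a k - t k ≫ seqι a (k + 1) :=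
  Sigma.ι_desc (fun k : ULift.{v} ℕ => seqι a k.down - t k.down ≫ seqι a (k.down + 1)) ⟨k⟩

variable {a t}

lemma seqSigma_hom_ext {X : C} {f g : seqSigma a ⟶ X} (h : ∀ k, seqι a k ≫ f = seqι a k ≫ g) :
    f = g :=
  Sigma.hom_ext _ _ fun k => h k.down

lemma IsCompactObj.eq_zero_of_comp_telescopeMap {q : C} (hq : IsCompactObj q)
    (φ : q ⟶ seqSigma a) (hφ : φ ≫ telescopeMap a t = 0) : φ = 0 := by
  let π (k : ℕ) : seqSigma a ⟶ a k := sigmaProj (fun k : ULift.{v} ℕ => a k.down) ⟨k⟩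
  have hself (k : ℕ) : seqι a k ≫ π k = 𝟙 _ := ι_sigmaProj_self _ _
  have hne {k l : ℕ} (h : k ≠ l) : seqι a k ≫ π l = 0 :=
    ι_sigmaProj_of_ne (fun k : ULift.{v} ℕ => a k.down) fun h' => h (congrArg ULift.down h')
  suffices h : ∀ k, φ ≫ π k = 0 from hq.eq_zero _ φ fun k => h k.down
  intro k
  induction k with
  | zero =>
    have h : telescopeMap a t ≫ π 0 = π 0 := seqSigma_hom_ext fun k => by
      rw [← Category.assoc, seqι_telescopeMap, Preadditive.sub_comp, Category.assoc,
        hne (Nat.succ_ne_zero k), comp_zero, sub_zero]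
    rw [← h, ← Category.assoc, hφ, zero_comp]
  | succ k ih =>
    have h : telescopeMap a t ≫ π (k + 1) = π (k + 1) - π k ≫ t k := seqSigma_hom_ext fun l => by
      rw [← Category.assoc, seqι_telescopeMap, Preadditive.sub_comp, Category.assoc,
        Preadditive.comp_sub]
      congr 1
      by_cases hl : l = k
      · subst hl
        rw [hself, ← Category.assoc, hself, Category.comp_id, Category.id_comp]
      · rw [hne (by simpa using hl), ← Category.assoc (seqι a l), hne hl, comp_zero, zero_comp]
    rw [← sub_add_cancel (π (k + 1)) (π k ≫ t k), ← h, Preadditive.comp_add, ← Category.assoc, hφ,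
      ← Category.assoc, ih, zero_comp, zero_comp, add_zero]

lemma exists_factor_of_le {q H : C} {c : seqSigma a ⟶ H} (hc : telescopeMap a t ≫ c = 0)
    {k m : ℕ} (hkm : k ≤ m) (g : q ⟶ a k) : ∃ r : q ⟶ a m, g ≫ seqι a k ≫ c = r ≫ seqι a m ≫ c := by
  induction m, hkm using Nat.le_induction with
  | base => exact ⟨g, rfl⟩
  | succ m _ ih =>
    obtain ⟨r, hr⟩ := ih
    refine ⟨r ≫ t m, ?_⟩
    have h : seqι a m ≫ c = t m ≫ seqι a (m + 1) ≫ c := by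
      rw [← sub_eq_zero, ← Category.assoc (t m), ← Preadditive.sub_comp, ← seqι_telescopeMap,
        Category.assoc, hc, comp_zero]
    rw [hr, h, Category.assoc]

lemma IsCompactObj.exists_factor {q H : C} (hq : IsCompactObj q) {c : seqSigma a ⟶ H}
    (hc : telescopeMap a t ≫ c = 0) (φ : q ⟶ seqSigma a) :
    ∃ (m : ℕ) (r : q ⟶ a m), φ ≫ c = r ≫ seqι a m ≫ c := by
  classical
  obtain ⟨s, hs⟩ := hq.exists_eq_sum _ φ
  generalize hg : (fun i : ULift.{v} ℕ => φ ≫ sigmaProj (fun k : ULift.{v} ℕ => a k.down) i) = g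
    at hs
  have hs' : φ = ∑ i ∈ s, g i ≫ seqι a i.down := by rw [← hg]; exact hs
  rw [hs']
  clear hs hs' hg
  induction s using Finset.induction_on with
  | empty => exact ⟨0, 0, by simp⟩
  | insert i s hi ih =>
    obtain ⟨m, r, hr⟩ := ih
    obtain ⟨r₁, h₁⟩ := exists_factor_of_le hc (le_max_left m i.down) r
    obtain ⟨r₂, h₂⟩ := exists_factor_of_le hc (le_max_right m i.down) (g i)
    refine ⟨max m i.down, r₂ + r₁, ?_⟩
    rw [Finset.sum_insert hi, Preadditive.add_comp, hr, h₁, Category.assoc, h₂,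
      Preadditive.add_comp]

lemma IsCompactObj.exists_factor_cone {q H : C} (hq : IsCompactObj q) {c : seqSigma a ⟶ H}
    {d : H ⟶ (seqSigma a)⟦(1 : ℤ)⟧} (hT : Triangle.mk (telescopeMap a t) c d ∈ distTriang C)
    (g : q ⟶ H) : ∃ (m : ℕ) (r : q ⟶ a m), g = r ≫ seqι a m ≫ c := by
  obtain ⟨φ, rfl⟩ := dist_lift₃ hT g
    (eq_zero_of_comp_shift_eq_zero
      (fun g' hg' => (hq.shift (-1)).eq_zero_of_comp_telescopeMap g' hg') _ (by
        rw [Category.assoc, dist_comp₃₁ hT, comp_zero]))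
  exact hq.exists_factor (dist_comp₁₂ hT) φ

end Telescope

section Approximation

lemma exists_dist_killing {ι : Type v} (q : ι → C) {S : Set C}
    (hq : ∀ i, bigClosure S ((q i)⟦(1 : ℤ)⟧)) {a X : C} (ha : bigClosure S a) (e : a ⟶ X) :
    ∃ (a' : C) (t : a ⟶ a') (e' : a' ⟶ X), bigClosure S a' ∧ t ≫ e' = e ∧
      ∀ i (g : q i ⟶ a), g ≫ e = 0 → g ≫ t = 0 := by
  let f : (Σ i, {g : q i ⟶ a // g ≫ e = 0}) → C := fun j => q j.1
  let φ : ∐ f ⟶ a := Sigma.desc fun j => j.2.1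
  obtain ⟨a', t, d, hT⟩ := distinguished_cocone_triangle φ
  obtain ⟨e', he'⟩ := dist_desc₂ hT e
    (Sigma.hom_ext _ _ fun j => by
      rw [← Category.assoc, Sigma.ι_desc, comp_zero]
      exact j.2.2)
  refine ⟨a', t, e', ?_, he', fun i g hg => ?_⟩
  · refine bigClosure.ext (rot_of_distTriang _ hT) ha ?_
    exact bigClosure.shift (S := Set.range f) (by rintro _ ⟨j, rfl⟩; exact hq j.1)
      (.coprod f fun j => .of ⟨j, rfl⟩)
  · have h : g = Sigma.ι f ⟨i, g, hg⟩ ≫ φ := by simp [φ]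
    rw [h, Category.assoc, dist_comp₁₂ hT, comp_zero]

/-- An object of `Coprod(S)` over `X`. -/
structure Approximation (S : Set C) (X : C) where
  /-- The approximating object. -/
  obj : C
  /-- The structure map. -/
  hom : obj ⟶ X
  mem : bigClosure S obj

/-- A set of compact objects generating its own shifts defines an aisle. -/
lemma exists_approximation {ι : Type v} (p : ι → C) (hp : ∀ i, IsCompactObj (p i))
    (hp' : ∀ i, bigClosure (Set.range p) ((p i)⟦(1 : ℤ)⟧)) (X : C) :
    ∃ (a y : C) (_ : bigClosure (Set.range p) a) (_ : ∀ i, HomZero (p i) y)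
      (f : a ⟶ X) (g : X ⟶ y) (h : y ⟶ a⟦(1 : ℤ)⟧), Triangle.mk f g h ∈ distTriang C := by
  let f₀ : (Σ i, (p i ⟶ X)) → C := fun j => p j.1
  let A₀ : Approximation (Set.range p) X :=
    ⟨∐ f₀, Sigma.desc fun j => j.2, .coprod f₀ fun j => .of ⟨j.1, rfl⟩⟩
  have hA₀ : ∀ i (g : p i ⟶ X), ∃ g', g' ≫ A₀.hom = g := fun i g =>
    ⟨Sigma.ι f₀ ⟨i, g⟩, Sigma.ι_desc _ _⟩
  have step (A : Approximation (Set.range p) X) : ∃ (A' : Approximation (Set.range p) X)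
      (t : A.obj ⟶ A'.obj), t ≫ A'.hom = A.hom ∧
        ∀ i (g : (p i)⟦(-1 : ℤ)⟧ ⟶ A.obj), g ≫ A.hom = 0 → g ≫ t = 0 := by
    obtain ⟨a', t, e', h₁, h₂, h₃⟩ := exists_dist_killing (fun i => (p i)⟦(-1 : ℤ)⟧)
      (fun i => (bigClosure.of (S := Set.range p) ⟨i, rfl⟩).of_iso
        (shiftShiftIsoSelf (p i) (-1) 1 (by simp)).symm) A.mem A.hom
    exact ⟨⟨a', e', h₁⟩, t, h₂, h₃⟩
  choose next t ht ht' using step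
  let A : ℕ → Approximation (Set.range p) X := Nat.rec A₀ fun _ => next
  let a (k : ℕ) : C := (A k).obj
  let τ (k : ℕ) : a k ⟶ a (k + 1) := t (A k)
  obtain ⟨H, c, d, hH⟩ := distinguished_cocone_triangle (telescopeMap a τ)
  have hc := dist_comp₁₂ hH
  let ε : seqSigma a ⟶ X := Sigma.desc fun k => (A k.down).hom
  have hε (k : ℕ) : seqι a k ≫ ε = (A k).hom :=
    Sigma.ι_desc (fun k : ULift.{v} ℕ => (A k.down).hom) ⟨k⟩
  obtain ⟨E, hE⟩ := dist_desc₂ hH ε (seqSigma_hom_ext fun k => by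
    rw [comp_zero, ← Category.assoc, seqι_telescopeMap, Preadditive.sub_comp, Category.assoc, hε,
      hε, sub_eq_zero]
    exact (ht (A k)).symm)
  have hEA (k : ℕ) : seqι a k ≫ c ≫ E = (A k).hom := by rw [hE, hε]
  have hmem : bigClosure (Set.range p) (seqSigma a) := .coprod _ fun k => (A k.down).mem
  have hinj (i) (g : (p i)⟦(-1 : ℤ)⟧ ⟶ H) (hg : g ≫ E = 0) : g = 0 := by
    obtain ⟨m, r, rfl⟩ := ((hp i).shift (-1)).exists_factor_cone hH g
    simp only [Category.assoc, hEA] at hg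
    have h : seqι a m ≫ c = τ m ≫ seqι a (m + 1) ≫ c := by
      rw [← sub_eq_zero, ← Category.assoc (τ m), ← Preadditive.sub_comp, ← seqι_telescopeMap,
        Category.assoc, hc, comp_zero]
    have h' : r ≫ τ m = 0 := ht' (A m) i r hg
    rw [h, ← Category.assoc, h', zero_comp]
  obtain ⟨y, g, h, hT⟩ := distinguished_cocone_triangle E
  refine ⟨H, y, ?_, fun i f => ?_, E, g, h, hT⟩
  · exact bigClosure.ext (rot_of_distTriang _ hH) hmem
      (bigClosure.shift (by rintro _ ⟨i, rfl⟩; exact hp' i) hmem)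
  · obtain ⟨f', rfl⟩ := dist_lift₃ hT f
      (eq_zero_of_comp_shift_eq_zero (hinj i) _ (by
        rw [Category.assoc, dist_comp₃₁ hT, comp_zero]))
    obtain ⟨f'', rfl⟩ := hA₀ i f'
    have hE₀ : seqι a 0 ≫ c ≫ E = A₀.hom := hEA 0
    simp only [← hE₀, Category.assoc, dist_comp₁₂ hT, comp_zero]

end Approximation

section CompactObjects

lemma isTriangSub_coprodClosure {S : Set C} (hS : ∀ X ∈ S, ∀ n : ℤ, X⟦n⟧ ∈ S) :
    IsTriangSub {X | coprodClosure S X} where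
  zero _ hX := .zero hX
  isoClosed e hX := by
    obtain ⟨Z, g, h, hZ, hT⟩ := exists_dist_of_iso e
    exact .ext hT hX (.zero hZ)
  shift X hX n := by
    induction hX with
    | of hX => exact .of (hS _ hX n)
    | zero hX => exact .zero ((shiftFunctor C n).map_isZero hX)
    | ext hT _ _ h₁ h₃ => exact .ext (Triangle.shift_distinguished _ hT n) h₁ h₃
  ext _ hT h₁ h₃ := .ext hT h₁ h₃

/-- The morphism `f` factors through an object of `S`. -/
def FactorsThrough (S : Set C) {X Y : C} (f : X ⟶ Y) : Prop :=
  ∃ (c : C) (_ : c ∈ S) (g : X ⟶ c) (h : c ⟶ Y), g ≫ h = f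

lemma FactorsThrough.add {S : Set C} (hS : IsTriangSub S) {X Y : C} {f f' : X ⟶ Y}
    (hf : FactorsThrough S f) (hf' : FactorsThrough S f') : FactorsThrough S (f + f') := by
  obtain ⟨c, hc, g, h, rfl⟩ := hf
  obtain ⟨c', hc', g', h', rfl⟩ := hf'
  exact ⟨c ⊞ c', hS.ext _ (binaryBiproductTriangle_distinguished c c') hc hc',
    biprod.lift g g', biprod.desc h h', by simp⟩

lemma FactorsThrough.comp {S : Set C} {X Y Z : C} {f : X ⟶ Y}
    (hf : FactorsThrough S f) (k : Y ⟶ Z) : FactorsThrough S (f ≫ k) := by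
  obtain ⟨c, hc, g, h, rfl⟩ := hf
  exact ⟨c, hc, g, h ≫ k, by simp⟩

lemma FactorsThrough.zero {S : Set C} (hS : IsTriangSub S) (X Y : C) :
    FactorsThrough S (0 : X ⟶ Y) := by
  open scoped ZeroObject in
  exact ⟨0, hS.zero _ (isZero_zero C), 0, 0, by simp⟩

lemma FactorsThrough.sum {S : Set C} (hS : IsTriangSub S) {X Y : C} {ι : Type*} (s : Finset ι)
    (f : ι → (X ⟶ Y)) (hf : ∀ i, FactorsThrough S (f i)) : FactorsThrough S (∑ i ∈ s, f i) :=
  Finset.sum_induction _ _ (fun _ _ => .add hS) (.zero hS X Y) fun i _ => hf i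

/-- Every morphism from a compact object to `Y` factors through an object of `S`. -/
def CompactsFactor (S : Set C) (Y : C) : Prop :=
  ∀ ⦃x : C⦄, IsCompactObj x → ∀ f : x ⟶ Y, FactorsThrough S f

lemma CompactsFactor.shift {S : Set C} (hS : IsTriangSub S) {Y : C} (hY : CompactsFactor S Y)
    (n : ℤ) : CompactsFactor S (Y⟦n⟧) := fun x hx f => by
  let e := shiftShiftIsoSelf x (-n) n (by simp)
  obtain ⟨f', hf'⟩ := (shiftFunctor C n).map_surjective (e.hom ≫ f)
  obtain ⟨c, hc, g, h, rfl⟩ := hY (hx.shift (-n)) f'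
  refine ⟨c⟦n⟧, hS.shift _ hc n, e.inv ≫ g⟦n⟧', h⟦n⟧', ?_⟩
  rw [Category.assoc, ← Functor.map_comp, hf', Iso.inv_hom_id_assoc]

lemma CompactsFactor.coprod {S : Set C} (hS : IsTriangSub S) {α : Type v} (f : α → C)
    (hf : ∀ i, CompactsFactor S (f i)) : CompactsFactor S (∐ f) := fun x hx φ => by
  obtain ⟨s, hs⟩ := hx.exists_eq_sum f φ
  rw [hs]
  exact .sum hS s _ fun i => (hf i hx _).comp _

lemma CompactsFactor.ext {S : Set C} (hS : IsTriangSub S) (hS' : S ⊆ compacts) {X Y Z : C}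
    {u : X ⟶ Y} {v : Y ⟶ Z}
    {w : Z ⟶ X⟦(1 : ℤ)⟧} (hT : Triangle.mk u v w ∈ distTriang C) (hX : CompactsFactor S X)
    (hZ : CompactsFactor S Z) : CompactsFactor S Y := fun x hx f => by
  obtain ⟨c₃, hc₃, α, β, hαβ⟩ := hZ hx (f ≫ v)
  obtain ⟨c₁, hc₁, γ, δ, hγδ⟩ := hX.shift hS 1 (hS' hc₃) (β ≫ w)
  obtain ⟨z, ζ, d, hz⟩ := distinguished_cocone_triangle (α ≫ γ)
  have hzc : IsCompactObj z := isTriangSub_compacts.obj₃_mem hz hx (hS' hc₁)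
  obtain ⟨δ, rfl⟩ := dist_desc₂ hz δ (by
    rw [Category.assoc, hγδ, ← Category.assoc, hαβ, Category.assoc, dist_comp₂₃ hT, comp_zero])
  obtain ⟨c₁', hc₁', ε, η, rfl⟩ := hX.shift hS 1 hzc δ
  obtain ⟨w', p, q, hw'⟩ := distinguished_cocone_triangle₁ (γ ≫ ζ ≫ ε)
  obtain ⟨(θ : w' ⟶ Y), hθ, -⟩ := complete_distinguished_triangle_morphism₁ _ _ hw'
    (rot_of_distTriang _ hT) β η (by
      change (γ ≫ ζ ≫ ε) ≫ η = β ≫ w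
      rw [← hγδ]
      simp only [Category.assoc])
  change p ≫ β = θ ≫ v at hθ
  obtain ⟨α', rfl⟩ := dist_lift₂ hw' α (by
    rw [← Category.assoc, ← Category.assoc, dist_comp₁₂ hz, zero_comp])
  obtain ⟨l, hl⟩ := dist_lift₂ hT (f - α' ≫ θ) (by
    rw [Preadditive.sub_comp, ← hαβ, Category.assoc, Category.assoc, hθ, sub_self])
  have hw'S : w' ∈ S :=
    hS.obj₁_mem hw' hc₃ hc₁'
  rw [← sub_add_cancel f (α' ≫ θ), ← hl]
  exact ((hX hx l).comp u).add hS ⟨w', hw'S, α', θ, rfl⟩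

lemma compactsFactor_of_bigClosure {S : Set C} (hS : IsTriangSub S) (hS' : S ⊆ compacts) {Y : C}
    (hY : bigClosure S Y) : CompactsFactor S Y := by
  induction hY with
  | of hX => exact fun x _ f => ⟨_, hX, f, 𝟙 _, by simp⟩
  | zero hX => exact fun x _ f => (hX.eq_of_tgt 0 f) ▸ .zero hS _ _
  | coprod f _ ih => exact .coprod hS f ih
  | ext hT _ _ h₁ h₃ => exact .ext hS hS' hT h₁ h₃

/-- If a triangulated subcategory `S` of the compact objects generates under coproducts, then every
compact object is a retract of an object of `S`. -/
lemma IsCompactObj.mem_smd {S : Set C} (hS : IsTriangSub S) (hS' : S ⊆ compacts)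
    (hgen : ∀ Y, bigClosure S Y) {X : C} (hX : IsCompactObj X) : X ∈ smd S := by
  obtain ⟨c, hc, g, h, hgh⟩ := compactsFactor_of_bigClosure hS hS' (hgen X) hX (𝟙 X)
  exact ⟨c, hc, g, h, hgh⟩

lemma shift_mem_shiftSet {G X : C} (hX : X ∈ shiftSet G Set.univ) (n : ℤ) :
    X⟦n⟧ ∈ shiftSet G Set.univ := by
  obtain ⟨i, -, ⟨e⟩⟩ := hX
  exact ⟨i - n, trivial, ⟨(shiftFunctor C n).mapIso e ≪≫ shiftShiftIso G (-i) n _ (by ring)⟩⟩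

lemma shift_self_mem_shiftSet (G : C) (n : ℤ) : G⟦n⟧ ∈ shiftSet G Set.univ :=
  ⟨-n, trivial, ⟨eqToIso (by rw [neg_neg])⟩⟩

lemma exists_approximation_shifts {P : C} (hP : IsCompactObj P) (X : C) :
    ∃ (a y : C) (_ : bigClosure (Set.range fun n : ℤ => P⟦n⟧) a) (_ : ∀ n : ℤ, HomZero (P⟦n⟧) y)
      (f : a ⟶ X) (g : X ⟶ y) (h : y ⟶ a⟦(1 : ℤ)⟧), Triangle.mk f g h ∈ distTriang C := by
  obtain ⟨a, y, ha, hy, f, g, h, hT⟩ := exists_approximation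
    (fun n : ULift.{v} ℤ => P⟦n.down⟧) (fun n => hP.shift n.down)
    (fun n => (bigClosure.of (S := Set.range _) ⟨⟨n.down + 1⟩, rfl⟩).of_iso
      (shiftShiftIso P n.down 1 _ rfl).symm) X
  exact ⟨a, y, ha.le (by rintro _ ⟨n, rfl⟩; exact .of ⟨n.down, rfl⟩), fun n => hy ⟨n⟩, f, g, h, hT⟩

lemma IsSingleCompactGenerator.bigClosure_shifts {G : C} (hG : IsSingleCompactGenerator G) (X : C) :
    bigClosure (Set.range fun n : ℤ => G⟦n⟧) X := by
  obtain ⟨a, y, ha, hy, f, g, h, hT⟩ := exists_approximation_shifts hG.compact X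
  exact .ext hT ha (.zero (hG.generates y hy))

/-- An induction principle for compact objects. -/
lemma IsSingleCompactGenerator.compact_induction {G : C} (hG : IsSingleCompactGenerator G)
    {P : C → Prop} (shift : ∀ n : ℤ, P (G⟦n⟧)) (zero : ∀ X, IsZero X → P X)
    (ext : ∀ T ∈ distTriang C, P T.obj₁ → P T.obj₃ → P T.obj₂)
    (retract : ∀ X Y (i : X ⟶ Y) (r : Y ⟶ X), i ≫ r = 𝟙 X → P Y → P X)
    {X : C} (hX : IsCompactObj X) : P X := by
  have hcomp : {X | coprodClosure (shiftSet G Set.univ) X} ⊆ compacts := by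
    intro X hX
    induction hX with
    | of hX =>
      obtain ⟨i, -, ⟨e⟩⟩ := hX
      exact (hG.compact.shift (-i)).of_iso e.symm
    | zero hX => exact isTriangSub_compacts.zero _ hX
    | ext hT _ _ h₁ h₃ => exact .ext hT h₁ h₃
  obtain ⟨Y, hY, i, r, hir⟩ := IsCompactObj.mem_smd
    (isTriangSub_coprodClosure fun X hX n => shift_mem_shiftSet hX n) hcomp
    (fun Y => (hG.bigClosure_shifts Y).le (by
      rintro _ ⟨n, rfl⟩
      exact .of (.of (shift_self_mem_shiftSet G n)))) hX
  refine retract X Y i r hir ?_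
  clear hir r i
  induction hY with
  | of hX =>
    obtain ⟨i, -, ⟨e⟩⟩ := hX
    exact retract _ _ e.hom e.inv e.hom_inv_id (shift _)
  | zero hX => exact zero _ hX
  | ext hT _ _ h₁ h₃ => exact ext _ hT h₁ h₃

end CompactObjects

section Aisle

lemma dist_of_iso₂ {X Y Z Y' : C} {f : X ⟶ Y} {g : Y ⟶ Z} {h : Z ⟶ X⟦(1 : ℤ)⟧}
    (hT : Triangle.mk f g h ∈ distTriang C) (e : Y ≅ Y') :
    Triangle.mk (f ≫ e.hom) (e.inv ≫ g) h ∈ distTriang C :=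
  isomorphic_distinguished _ hT _ (Triangle.isoMk _ _ (Iso.refl X) e.symm (Iso.refl Z)
    (show (f ≫ e.hom) ≫ e.inv = 𝟙 X ≫ f by simp) (show (e.inv ≫ g) ≫ 𝟙 Z = e.inv ≫ g by simp)
    (show h ≫ (𝟙 X)⟦(1 : ℤ)⟧' = 𝟙 Z ≫ h by simp))

lemma dist_lift_shift {X Y Z W : C} {f : X ⟶ Y} {g : Y ⟶ Z} {h : Z ⟶ X⟦(1 : ℤ)⟧}
    (hT : Triangle.mk f g h ∈ distTriang C) (φ : W ⟶ Y⟦(1 : ℤ)⟧) (hφ : φ ≫ g⟦(1 : ℤ)⟧' = 0) :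
    ∃ ψ : W ⟶ X⟦(1 : ℤ)⟧, ψ ≫ f⟦(1 : ℤ)⟧' = φ := by
  let e := shiftShiftIsoSelf W (-1) 1 (by simp)
  obtain ⟨k, hk⟩ := (shiftFunctor C (1 : ℤ)).map_surjective (e.hom ≫ φ)
  obtain ⟨l, rfl⟩ := dist_lift₂ hT k ((shiftFunctor C (1 : ℤ)).map_injective (by
    rw [Functor.map_comp, hk, Category.assoc, hφ, comp_zero, Functor.map_zero]))
  exact ⟨e.inv ≫ l⟦(1 : ℤ)⟧', by
    rw [Category.assoc, ← Functor.map_comp, hk, Iso.inv_hom_id_assoc]⟩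

/-- The objects receiving no nonzero morphisms from `G⟦j⟧` for `j ≥ n`. -/
def coaisle (G : C) (n : ℤ) : Set C := {V | ∀ j : ℤ, n ≤ j → HomZero (G⟦j⟧) V}

/-- The aisle generated by the objects `G⟦j⟧` for `j ≥ n`. -/
def aisle (G : C) (n : ℤ) : Set C := lOrth (coaisle G n)

lemma rOrth_genInt (G : C) (n : ℤ) : rOrth (genInt G (Set.Iic (-n))) = coaisle G n := by
  ext V
  constructor
  · intro hV j hj
    refine hV ⟨G⟦j⟧, .of ⟨-j, neg_le_neg hj, ⟨eqToIso (by rw [neg_neg])⟩⟩, 𝟙 _, 𝟙 _, by simp⟩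
  · rintro hV X ⟨Y, hY, i, r, hir⟩
    refine HomZero.retract_left ?_ i r hir
    clear hir r i
    induction hY with
    | of hX =>
      obtain ⟨i, hi, ⟨e⟩⟩ := hX
      exact (hV (-i) (le_neg_of_le_neg hi)).of_iso e.symm (Iso.refl _)
    | zero hX => exact .of_isZero_left hX
    | ext hT _ _ h₁ h₃ => exact .ext_left hT h₁ h₃

variable {G : C} {n n' : ℤ}

lemma coaisle_mono (h : n ≤ n') : coaisle G n ⊆ coaisle G n' :=
  fun _ hV j hj => hV j (h.trans hj)

lemma coaisle_shift {V : C} (hV : V ∈ coaisle G n) (m : ℤ) (h : n + m ≤ n') :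
    V⟦m⟧ ∈ coaisle G n' := fun j hj =>
  (homZero_shift_left_iff _ _ (-m) m (by simp)).1
    ((hV (j - m) (by omega)).of_iso (shiftShiftIso G j (-m) _ (by ring)).symm (Iso.refl _))

lemma coaisle_ext {T : Triangle C} (hT : T ∈ distTriang C) (h₁ : T.obj₁ ∈ coaisle G n)
    (h₃ : T.obj₃ ∈ coaisle G n) : T.obj₂ ∈ coaisle G n :=
  fun j hj => .ext_right hT (h₁ j hj) (h₃ j hj)

lemma aisle_antitone (h : n' ≤ n) : aisle G n ⊆ aisle G n' :=
  fun _ hX _ hV => hX (coaisle_mono h hV)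

lemma aisle_shift {X : C} (hX : X ∈ aisle G n) (m : ℤ) (h : n' ≤ n + m) :
    X⟦m⟧ ∈ aisle G n' := fun _ hV =>
  (homZero_shift_left_iff _ _ m (-m) (by simp)).2 (hX (coaisle_shift hV (-m) (by omega)))

lemma aisle_ext {T : Triangle C} (hT : T ∈ distTriang C) (h₁ : T.obj₁ ∈ aisle G n)
    (h₃ : T.obj₃ ∈ aisle G n) : T.obj₂ ∈ aisle G n :=
  fun _ hV => HomZero.ext_left hT (h₁ hV) (h₃ hV)

lemma shift_mem_aisle (j : ℤ) : G⟦j⟧ ∈ aisle G j := fun _ hV => hV j le_rfl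

lemma aisle_induction (hG : IsCompactObj G) {P : C → Prop} (shift : ∀ j : ℤ, n ≤ j → P (G⟦j⟧))
    (zero : ∀ X, IsZero X → P X) (coprod : ∀ {α : Type v} (f : α → C), (∀ i, P (f i)) → P (∐ f))
    (ext : ∀ T ∈ distTriang C, P T.obj₁ → P T.obj₃ → P T.obj₂)
    (retract : ∀ X Y (i : X ⟶ Y) (r : Y ⟶ X), i ≫ r = 𝟙 X → P Y → P X)
    {X : C} (hX : X ∈ aisle G n) : P X := by
  obtain ⟨a, y, ha, hy, f, g, h, hT⟩ := exists_approximation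
    (fun j : ULift.{v} {j : ℤ // n ≤ j} => G⟦j.down.1⟧) (fun j => hG.shift _)
    (fun j => (bigClosure.of (S := Set.range _)
      ⟨⟨j.down.1 + 1, by have := j.down.2; omega⟩, rfl⟩).of_iso
      (shiftShiftIso G j.down.1 1 _ rfl).symm) X
  obtain ⟨s, hs⟩ := dist_lift₂ hT (𝟙 X) (hX (fun j hj => hy ⟨j, hj⟩) _)
  refine retract X a s f hs ?_
  clear hs s hT f h
  induction ha with
  | of hX =>
    obtain ⟨j, rfl⟩ := hX
    exact shift _ j.down.2
  | zero hX => exact zero _ hX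
  | coprod f _ ih => exact coprod f ih
  | ext hT _ _ h₁ h₃ => exact ext _ hT h₁ h₃

lemma IsCompactObj.exists_mem_aisle (hG : IsSingleCompactGenerator G) {X : C}
    (hX : IsCompactObj X) : ∃ k, X ∈ aisle G k := by
  refine hG.compact_induction (P := fun X => ∃ k, X ∈ aisle G k) ?_ ?_ ?_ ?_ hX
  · exact fun n => ⟨n, shift_mem_aisle n⟩
  · exact fun X hX => ⟨0, fun _ _ => HomZero.of_isZero_left hX⟩
  · rintro T hT ⟨k₁, h₁⟩ ⟨k₃, h₃⟩
    exact ⟨min k₁ k₃, aisle_ext hT (aisle_antitone (min_le_left _ _) h₁)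
      (aisle_antitone (min_le_right _ _) h₃)⟩
  · rintro X Y i r hir ⟨k, hk⟩
    exact ⟨k, fun _ hV => (HomZero.retract_left (hk hV) i r hir)⟩

lemma IsCompactObj.exists_mem_lOrth_aisle (hG : IsSingleCompactGenerator G)
    (hvanish : ∃ N : ℕ, ∀ n : ℤ, (N : ℤ) ≤ n → ∀ f : G ⟶ G⟦n⟧, f = 0) {X : C}
    (hX : IsCompactObj X) : ∃ m, X ∈ lOrth (aisle G m) := by
  refine hG.compact_induction (P := fun X => ∃ m, X ∈ lOrth (aisle G m)) ?_ ?_ ?_ ?_ hX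
  · obtain ⟨N, hN⟩ := hvanish
    refine fun n => ⟨n + N, fun Y hY => ?_⟩
    refine aisle_induction (P := HomZero (G⟦n⟧)) hG.compact ?_ ?_ ?_ ?_ ?_ hY
    · exact fun j hj => (homZero_shift_left_iff _ _ n (-n) (by simp)).2
        (HomZero.of_iso (hN (j - n) (by omega)) (Iso.refl _)
          (shiftShiftIso G j (-n) _ (by ring)).symm)
    · exact fun X hX => .of_isZero_right hX
    · exact fun f ih φ => (hG.compact.shift n).eq_zero f φ fun i => ih i _
    · exact fun T hT h₁ h₃ => .ext_right hT h₁ h₃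
    · exact fun X Y i r hir h => .retract_right h i r hir
  · exact fun X hX => ⟨0, fun _ _ => HomZero.of_isZero_left hX⟩
  · rintro T hT ⟨k₁, h₁⟩ ⟨k₃, h₃⟩
    exact ⟨max k₁ k₃, fun _ hY => HomZero.ext_left hT (h₁ (aisle_antitone (le_max_left _ _) hY))
      (h₃ (aisle_antitone (le_max_right _ _) hY))⟩
  · rintro X Y i r hir ⟨k, hk⟩
    exact ⟨k, fun _ hV => (HomZero.retract_left (hk hV) i r hir)⟩

end Aisle

section BoundedClosure

/-- The subcategory `T^b_c` attached to a compact generator `G`. -/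
def tbc (G : C) : Set C :=
  {F | (∀ n, F ∈ star compacts (aisle G n)) ∧ ∃ n, F ∈ coaisle G n}

lemma tbc_eq (G : C) : tbc G =
    closureCompacts (fun n => lOrth (rOrth (genInt G (Set.Iic (-n))))) ∩
      ⋃ n : ℤ, rOrth (genInt G (Set.Iic (-n))) := by
  simp only [rOrth_genInt]
  ext F
  rw [Set.mem_inter_iff, Set.mem_iUnion]
  rfl

lemma contraBij_of_mem_aisle {G : C} {n : ℤ} {T : Triangle C} (hT : T ∈ distTriang C)
    (h : T.obj₃ ∈ aisle G (n + 2)) {V : C} (hV : V ∈ coaisle G (n + 1)) : ContraBij V T.mor₁ :=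
  contraBij_mor₁ hT (h (coaisle_mono (by omega) hV)) (h (coaisle_shift hV 1 (by omega)))

lemma star_compacts_aisle_ext {G : C} (hG : IsSingleCompactGenerator G)
    (hvanish : ∃ N : ℕ, ∀ n : ℤ, (N : ℤ) ≤ n → ∀ f : G ⟶ G⟦n⟧, f = 0) {F₁ F₂ F₃ : C}
    {u : F₁ ⟶ F₂} {v : F₂ ⟶ F₃} {w : F₃ ⟶ F₁⟦(1 : ℤ)⟧} (hT : Triangle.mk u v w ∈ distTriang C)
    (h₁ : ∀ n, F₁ ∈ star compacts (aisle G n)) (h₃ : ∀ n, F₃ ∈ star compacts (aisle G n)) (n : ℤ) :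
    F₂ ∈ star compacts (aisle G n) := by
  obtain ⟨C₃, R₃, hC₃, hR₃, f₃, g₃, d₃, hT₃⟩ := h₃ (n + 2)
  obtain ⟨m, hm⟩ := IsCompactObj.exists_mem_lOrth_aisle hG hvanish hC₃
  obtain ⟨C₁, R₁, hC₁, hR₁, f₁, g₁, d₁, hT₁⟩ := h₁ (max (n + 2) m)
  obtain ⟨w', hw'⟩ := dist_lift_shift hT₁ (f₃ ≫ w)
    (hm (aisle_shift hR₁ 1 (by have := le_max_right (n + 2) m; omega)) _)
  obtain ⟨C₂, u', v', hT'⟩ := distinguished_cocone_triangle₂ w'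
  obtain ⟨(f₂ : C₂ ⟶ F₂), h₁₂, h₂₃⟩ :=
    complete_distinguished_triangle_morphism₂ _ _ hT' hT f₁ f₃ hw'
  let φ : Triangle.mk u' v' w' ⟶ Triangle.mk u v w :=
    { hom₁ := f₁, hom₂ := f₂, hom₃ := f₃, comm₁ := h₁₂, comm₂ := h₂₃, comm₃ := hw' }
  have hR₁' : R₁ ∈ aisle G (n + 2) := aisle_antitone (le_max_left _ _) hR₁
  have H {V : C} (hV : V ∈ coaisle G n) : ContraBij V f₂ :=
    contraBij₂ hT' hT φ (contraBij_of_mem_aisle hT₁ hR₁' (coaisle_mono (by omega) hV))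
      (contraBij_of_mem_aisle hT₁ hR₁' (coaisle_shift hV (-1) (by omega)))
      (contraBij_of_mem_aisle hT₃ hR₃ (coaisle_mono (by omega) hV))
      (contraBij_of_mem_aisle hT₃ hR₃ (coaisle_shift hV 1 (by omega)))
  obtain ⟨R₂, g₂, d₂, hT₂⟩ := distinguished_cocone_triangle f₂
  exact ⟨C₂, R₂, isTriangSub_compacts.ext _ hT' hC₁ hC₃, fun V hV =>
    homZero_obj₃_of_contraBij hT₂ (H hV) (H (coaisle_shift hV (-1) (by omega))), f₂, g₂, d₂, hT₂⟩

lemma isTriangSub_tbc {G : C} (hG : IsSingleCompactGenerator G)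
    (hvanish : ∃ N : ℕ, ∀ n : ℤ, (N : ℤ) ≤ n → ∀ f : G ⟶ G⟦n⟧, f = 0) :
    IsTriangSub (tbc G) where
  zero X hX := by
    open scoped ZeroObject in
    exact ⟨fun n => ⟨X, 0, isTriangSub_compacts.zero X hX,
      fun _ _ => HomZero.of_isZero_left (isZero_zero C), _, _, _, contractible_distinguished X⟩,
      0, fun _ _ => .of_isZero_right hX⟩
  isoClosed e := by
    rintro ⟨h, n, hn⟩
    refine ⟨fun m => ?_, n, fun j hj => (hn j hj).of_iso (Iso.refl _) e⟩
    obtain ⟨A, B, hA, hB, f, g, d, hT⟩ := h m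
    exact ⟨A, B, hA, hB, _, _, _, dist_of_iso₂ hT e⟩
  shift X := by
    rintro ⟨h, n, hn⟩ m
    refine ⟨fun k => ?_, n + m, coaisle_shift hn m le_rfl⟩
    obtain ⟨A, B, hA, hB, f, g, d, hT⟩ := h (k - m)
    exact ⟨A⟦m⟧, B⟦m⟧, hA.shift m, aisle_shift hB m (by omega), _, _, _,
      Triangle.shift_distinguished _ hT m⟩
  ext T hT := by
    rintro ⟨h₁, n₁, hn₁⟩ ⟨h₃, n₃, hn₃⟩
    exact ⟨star_compacts_aisle_ext hG hvanish hT h₁ h₃, max n₁ n₃,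
      coaisle_ext hT (coaisle_mono (le_max_left _ _) hn₁) (coaisle_mono (le_max_right _ _) hn₃)⟩

end BoundedClosure

section Coreflection

/-- `e : a ⟶ X` exhibits `a` as the coreflection of `X` in `Coprod(A)`. -/
structure IsCoreflection (A : Set C) {a X : C} (e : a ⟶ X) : Prop where
  mem : a ∈ CoprodSet A
  covBij : ∀ w ∈ CoprodSet A, CovBij w e

variable {A : Set C}

lemma isCoreflection_of_dist (hA : IsTriangSub A) {T : Triangle C} (hT : T ∈ distTriang C)
    (h₁ : T.obj₁ ∈ CoprodSet A) (h₃ : T.obj₃ ∈ rOrth A) : IsCoreflection A T.mor₁ where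
  mem := h₁
  covBij w hw := covBij_mor₁ hT (bigClosure.homZero hw fun _ hs => h₃ hs)
    (bigClosure.homZero ((isTriangSub_coprodSet hA).shift w hw 1) fun _ hs => h₃ hs)

lemma isCoreflection_of_covBij (hA : IsTriangSub A) {a X : C} {e : a ⟶ X} (ha : a ∈ CoprodSet A)
    (he : ∀ w ∈ A, CovBij w e) : IsCoreflection A e := by
  obtain ⟨y, g, d, hT⟩ := distinguished_cocone_triangle e
  exact isCoreflection_of_dist hA hT ha fun w hw =>
    homZero_obj₃_of_covBij hT (he w hw) (he _ (hA.shift w hw (-1)))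

namespace IsCoreflection

lemma shift (hA : IsTriangSub A) {a X : C} {e : a ⟶ X} (he : IsCoreflection A e) (n : ℤ) :
    IsCoreflection A (e⟦n⟧') where
  mem := (isTriangSub_coprodSet hA).shift a he.mem n
  covBij w hw := (he.covBij _ ((isTriangSub_coprodSet hA).shift w hw (-n))).shift_map n (-n)
    (by simp)

lemma exists_retract {a b X Y : C} {e : a ⟶ X} {e' : b ⟶ Y} (he : IsCoreflection A e)
    (he' : IsCoreflection A e') {i : X ⟶ Y} {r : Y ⟶ X} (hir : i ≫ r = 𝟙 X) :
    ∃ (s : a ⟶ b) (t : b ⟶ a), s ≫ t = 𝟙 a := by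
  obtain ⟨s, hs⟩ := (he'.covBij a he.mem).exists_lift (e ≫ i)
  obtain ⟨t, ht⟩ := (he.covBij b he'.mem).exists_lift (e' ≫ r)
  refine ⟨s, t, (he.covBij a he.mem).1 ?_⟩
  dsimp only
  rw [Category.assoc, ht, ← Category.assoc, hs, Category.assoc, hir, Category.comp_id,
    Category.id_comp]

lemma isZero {a X : C} {e : a ⟶ X} (he : IsCoreflection A e) (hX : IsZero X) : IsZero a :=
  (IsZero.iff_id_eq_zero a).2 ((he.covBij a he.mem).eq_zero _ (hX.eq_of_tgt _ _))

lemma exists_cone (hA : IsTriangSub A) {a₁ a₂ X₁ X₂ X₃ : C} {e₁ : a₁ ⟶ X₁} {e₂ : a₂ ⟶ X₂}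
    {u : X₁ ⟶ X₂} {v : X₂ ⟶ X₃} {w : X₃ ⟶ X₁⟦(1 : ℤ)⟧} (h₁ : IsCoreflection A e₁)
    (h₂ : IsCoreflection A e₂) (hT : Triangle.mk u v w ∈ distTriang C) :
    ∃ (a₃ : C) (e₃ : a₃ ⟶ X₃) (u' : a₁ ⟶ a₂) (v' : a₂ ⟶ a₃) (w' : a₃ ⟶ a₁⟦(1 : ℤ)⟧),
      Triangle.mk u' v' w' ∈ distTriang C ∧ IsCoreflection A e₃ := by
  obtain ⟨u', hu'⟩ := (h₂.covBij a₁ h₁.mem).exists_lift (e₁ ≫ u)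
  obtain ⟨a₃, v', w', hT'⟩ := distinguished_cocone_triangle u'
  obtain ⟨(e₃ : a₃ ⟶ X₃), h₂₃, h₃₁⟩ := complete_distinguished_triangle_morphism _ _ hT' hT e₁ e₂ hu'
  have hA' := isTriangSub_coprodSet hA
  refine ⟨a₃, e₃, u', v', w', hT', hA'.obj₃_mem hT' h₁.mem h₂.mem, fun W hW => ?_⟩
  let φ : (Triangle.mk u' v' w').rotate ⟶ (Triangle.mk u v w).rotate :=
    { hom₁ := e₂, hom₂ := e₃, hom₃ := e₁⟦(1 : ℤ)⟧', comm₁ := h₂₃, comm₂ := h₃₁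
      comm₃ := by
        change (-u'⟦(1 : ℤ)⟧') ≫ e₂⟦(1 : ℤ)⟧' = e₁⟦(1 : ℤ)⟧' ≫ (-u⟦(1 : ℤ)⟧')
        rw [Preadditive.neg_comp, Preadditive.comp_neg, ← Functor.map_comp, ← Functor.map_comp,
          hu'] }
  exact covBij₂ (rot_of_distTriang _ hT') (rot_of_distTriang _ hT) φ (h₂.covBij W hW)
    (h₂.covBij _ (hA'.shift W hW (-1))) ((h₁.shift hA 1).covBij W hW)
    ((h₁.shift hA 1).covBij _ (hA'.shift W hW 1))

lemma sigmaMap (hA : IsTriangSub A) (hAc : A ⊆ compacts) {α : Type v} {a X : α → C}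
    {e : ∀ i, a i ⟶ X i} (he : ∀ i, IsCoreflection A (e i)) :
    IsCoreflection A (Limits.Sigma.map e) := by
  have hπ (i) : Limits.Sigma.map e ≫ sigmaProj X i = sigmaProj a i ≫ e i :=
    Sigma.hom_ext _ _ fun j => by
      rw [Sigma.ι_map_assoc]
      by_cases h : j = i
      · subst h
        rw [ι_sigmaProj_self, ← Category.assoc, ι_sigmaProj_self, Category.comp_id,
          Category.id_comp]
      · rw [ι_sigmaProj_of_ne _ h, ← Category.assoc, ι_sigmaProj_of_ne _ h, comp_zero, zero_comp]
  refine isCoreflection_of_covBij hA (bigClosure.coprod a fun i => (he i).mem) fun w hw =>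
    covBij_of (fun g hg => ?_) (fun g => ?_)
  · exact (hAc hw).eq_zero a g fun i => ((he i).covBij w (.of hw)).eq_zero _ (by
      rw [Category.assoc, ← hπ, ← Category.assoc, hg, zero_comp])
  · choose l hl using fun i => ((he i).covBij w (.of hw)).exists_lift (g ≫ sigmaProj X i)
    obtain ⟨s, hs⟩ := (hAc hw).exists_eq_sum X g
    refine ⟨∑ i ∈ s, l i ≫ Sigma.ι a i, ?_⟩
    rw [hs, Preadditive.sum_comp]
    refine Finset.sum_congr rfl fun i _ => ?_
    rw [Category.assoc, Sigma.ι_map, ← Category.assoc, hl]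

end IsCoreflection

end Coreflection

section Reflective

/-- A triangulated subcategory of the compact objects in which `G` has a reflection. -/
structure IsReflectiveAt (G : C) (A : Set C) : Prop where
  triang : IsTriangSub A
  compact : A ⊆ compacts
  exists_reflection : ∃ (z P : C) (_ : IsCompactObj z) (_ : z ∈ lOrth A) (_ : P ∈ A)
    (f : z ⟶ G) (g : G ⟶ P) (d : P ⟶ z⟦(1 : ℤ)⟧), Triangle.mk f g d ∈ distTriang C

lemma IsSOD.isReflectiveAt {A B : Set C} (h : IsSOD (compacts (C := C)) A B) {G : C}
    (hG : IsCompactObj G) : IsReflectiveAt G A where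
  triang := h.triangA
  compact := h.subsetA
  exists_reflection := by
    obtain ⟨z, P, hz, hP, f, g, d, hT⟩ := h.exists_reflection (X := G) hG
    exact ⟨z, P, isTriangSub_compacts.obj₁_mem hT hG (h.subsetA hP), hz, hP, f, g, d, hT⟩

lemma homZero_coprodSet_of_mem_lOrth {A : Set C} {z a : C} (hz : IsCompactObj z)
    (hzA : z ∈ lOrth A) (ha : a ∈ CoprodSet A) : HomZero z a :=
  hz.homZero_of_bigClosure (fun _ hs => hzA hs) ha

lemma homZero_shift_of_dist {z X P Y : C} {f : z ⟶ X} {g : X ⟶ P} {d : P ⟶ z⟦(1 : ℤ)⟧}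
    (hT : Triangle.mk f g d ∈ distTriang C) {n : ℤ} (hz : HomZero (z⟦n⟧) Y)
    (hP : HomZero (P⟦n⟧) Y) : HomZero (X⟦n⟧) Y :=
  HomZero.ext_left (Triangle.shift_distinguished _ hT n) hz hP

variable {G : C} {A : Set C}

/-- Every object has a coreflection in `Coprod(A)`. -/
lemma IsReflectiveAt.exists_dist (hG : IsSingleCompactGenerator G) (h : IsReflectiveAt G A)
    (X : C) : ∃ (a y : C) (_ : a ∈ CoprodSet A) (_ : y ∈ rOrth A) (f : a ⟶ X) (g : X ⟶ y)
      (d : y ⟶ a⟦(1 : ℤ)⟧), Triangle.mk f g d ∈ distTriang C := by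
  obtain ⟨z, P, hz, hzA, hP, f, g, d, hT⟩ := h.exists_reflection
  have hA := isTriangSub_coprodSet h.triang
  have hle {a : C} (ha : bigClosure (Set.range fun n : ℤ => P⟦n⟧) a) : a ∈ CoprodSet A :=
    ha.le (by rintro _ ⟨n, rfl⟩; exact .of (h.triang.shift P hP n))
  have hgen {a : C} (ha : a ∈ A) : bigClosure (Set.range fun n : ℤ => P⟦n⟧) a := by
    obtain ⟨b, y, hb, hy, f', g', d', hT'⟩ := exists_approximation_shifts (h.compact hP) a
    have hyA : y ∈ CoprodSet A := hA.obj₃_mem hT' (hle hb) (.of ha)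
    exact .ext hT' hb (.zero (hG.generates y fun n => homZero_shift_of_dist hT
      (homZero_coprodSet_of_mem_lOrth (hz.shift n) (h.triang.lOrth.shift z hzA n) hyA) (hy n)))
  obtain ⟨a, y, ha, hy, f', g', d', hT'⟩ := exists_approximation_shifts (h.compact hP) X
  exact ⟨a, y, hle ha, fun w hw => (hgen hw).homZero (by rintro _ ⟨n, rfl⟩; exact hy n),
    f', g', d', hT'⟩

lemma IsReflectiveAt.exists_isCoreflection (hG : IsSingleCompactGenerator G)
    (h : IsReflectiveAt G A) (X : C) : ∃ (a : C) (e : a ⟶ X), IsCoreflection A e := by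
  obtain ⟨a, y, ha, hy, f, g, d, hT⟩ := h.exists_dist hG X
  exact ⟨a, f, isCoreflection_of_dist h.triang hT ha hy⟩

lemma IsReflectiveAt.exists_coreflection_mem_aisle (hG : IsSingleCompactGenerator G)
    (h : IsReflectiveAt G A) {b : C} (hb : IsCompactObj b) {e' : b ⟶ G}
    (he' : IsCoreflection A e') : ∃ k, ∀ {N : ℤ} {X : C}, X ∈ aisle G N →
      ∀ {a : C} {e : a ⟶ X}, IsCoreflection A e → a ∈ aisle G (N + k) := by
  obtain ⟨k, hk⟩ := hb.exists_mem_aisle hG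
  refine ⟨k, fun {N X} hX {a e} he V hV => ?_⟩
  suffices H : ∀ (a : C) (e : a ⟶ X), IsCoreflection A e → HomZero a V from H a e he
  refine aisle_induction (P := fun X => ∀ (a : C) (e : a ⟶ X), IsCoreflection A e → HomZero a V)
    hG.compact ?_ ?_ ?_ ?_ ?_ hX
  · intro j hj a e he
    obtain ⟨s, t, hst⟩ := he.exists_retract (he'.shift h.triang j) (Category.comp_id _)
    exact .retract_left (aisle_shift hk j (by omega) hV) s t hst
  · exact fun X hX a e he => .of_isZero_left (he.isZero hX)
  · intro α f ih a e he
    choose a' e' he' using fun i => h.exists_isCoreflection hG (f i)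
    obtain ⟨s, t, hst⟩ := he.exists_retract (IsCoreflection.sigmaMap h.triang h.compact he')
      (Category.comp_id _)
    exact .retract_left (fun g => Sigma.hom_ext _ _ fun i =>
      (ih i _ _ (he' i) _).trans comp_zero.symm) s t hst
  · intro T hT ih₁ ih₃ a e he
    obtain ⟨a₁, e₁, he₁⟩ := h.exists_isCoreflection hG T.obj₁
    obtain ⟨a₃, e₃, u, v, w, hT', he₃⟩ := he₁.exists_cone h.triang he hT
    exact .ext_left hT' (ih₁ a₁ e₁ he₁) (ih₃ a₃ e₃ he₃)
  · intro X Y i r hir ih a e he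
    obtain ⟨b, e', he'⟩ := h.exists_isCoreflection hG Y
    obtain ⟨s, t, hst⟩ := he.exists_retract he' hir
    exact .retract_left (ih b e' he') s t hst

/-- The coreflection in `Coprod(A)` preserves `T^b_c` if that of compact objects is compact. -/
lemma IsReflectiveAt.coreflection_mem_tbc (hG : IsSingleCompactGenerator G)
    (h : IsReflectiveAt G A) (hco : ∀ X : C, IsCompactObj X → ∃ (b : C) (_ : b ∈ A) (e : b ⟶ X),
      IsCoreflection A e) {F a : C} (hF : F ∈ tbc G) {e : a ⟶ F} (he : IsCoreflection A e) :
    a ∈ tbc G := by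
  refine ⟨fun n => ?_, ?_⟩
  · obtain ⟨b, hb, e', he'⟩ := hco G hG.compact
    obtain ⟨k, hk⟩ := h.exists_coreflection_mem_aisle hG (h.compact hb) he'
    obtain ⟨X, R, hX, hR, f, g, d, hT⟩ := hF.1 (n - k)
    obtain ⟨c, hc, ε, hε⟩ := hco X hX
    obtain ⟨a₃, e₃, u, v, w, hT', he₃⟩ := hε.exists_cone h.triang he hT
    exact ⟨c, a₃, h.compact hc, aisle_antitone (by omega) (hk hR he₃), u, v, w, hT'⟩
  · obtain ⟨z, P, hz, hzA, hP, f, g, d, hT⟩ := h.exists_reflection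
    obtain ⟨k, hk⟩ := (h.compact hP).exists_mem_aisle hG
    obtain ⟨n, hn⟩ := hF.2
    exact ⟨n - k, fun j hj => homZero_shift_of_dist hT
      (homZero_coprodSet_of_mem_lOrth (hz.shift j) (h.triang.lOrth.shift z hzA j) he.mem)
      fun g => (he.covBij _ (.of (h.triang.shift P hP j))).eq_zero g
        (aisle_shift hk j (by omega) hn _)⟩

end Reflective

section Decomposition

variable {G : C} {A B : Set C}

lemma exists_dist_of_admissible (hG : IsSingleCompactGenerator G)
    (hvanish : ∃ N : ℕ, ∀ n : ℤ, (N : ℤ) ≤ n → ∀ f : G ⟶ G⟦n⟧, f = 0)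
    (hr : IsSOD (compacts (C := C)) (rOrth A ∩ compacts) A)
    (hl : IsSOD (compacts (C := C)) A (lOrth A ∩ compacts)) {F : C} (hF : F ∈ tbc G) :
    ∃ (a y : C) (_ : a ∈ CoprodSet A ∩ tbc G) (_ : y ∈ rOrth A ∩ tbc G) (f : a ⟶ F) (g : F ⟶ y)
      (d : y ⟶ a⟦(1 : ℤ)⟧), Triangle.mk f g d ∈ distTriang C := by
  have h := hl.isReflectiveAt hG.compact
  obtain ⟨a, y, ha, hy, f, g, d, hT⟩ := h.exists_dist hG F
  have ha' : a ∈ tbc G := h.coreflection_mem_tbc hG (fun X hX => by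
    obtain ⟨b, z, hb, hz, f, g, d, hT⟩ := hr.exists_coreflection hX
    exact ⟨b, hb, f, isCoreflection_of_dist h.triang hT (.of hb) hz⟩) hF
    (isCoreflection_of_dist h.triang hT ha hy)
  exact ⟨a, y, ⟨ha, ha'⟩, ⟨hy, (isTriangSub_tbc hG hvanish).obj₃_mem hT ha' hF⟩, f, g, d, hT⟩

lemma isSOD_of_exists_dist {D : Set C} (hD : IsTriangSub D) (hA : IsTriangSub A)
    (hB : IsTriangSub B) (hAD : A ⊆ D) (hBD : B ⊆ D) (h : ∀ b ∈ B, ∀ a ∈ A, HomZero b a)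
    (hex : ∀ F ∈ D, ∃ (b a : C) (_ : b ∈ B) (_ : a ∈ A) (f : b ⟶ F) (g : F ⟶ a)
      (d : a ⟶ b⟦(1 : ℤ)⟧), Triangle.mk f g d ∈ distTriang C) : IsSOD D A B where
  subsetA := hAD
  subsetB := hBD
  triangA := hA
  triangB := hB
  hom_zero := h
  generates := by
    refine Set.Subset.antisymm (hD.triangClosure_le (Set.union_subset hAD hBD)) fun F hF => ?_
    obtain ⟨b, a, hb, ha, f, g, d, hT⟩ := hex F hF
    exact triangClosure.ext hT (.of (Or.inr hb)) (.of (Or.inl ha))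

lemma IsSOD.mem_coprodSet (hG : IsSingleCompactGenerator G) (h : IsSOD (compacts (C := C)) A B)
    {y : C} (hy : y ∈ rOrth B) : y ∈ CoprodSet A := by
  obtain ⟨a, z, ha, hz, f, g, d, hT⟩ := (h.isReflectiveAt hG.compact).exists_dist hG y
  have haB : a ∈ rOrth B := fun b hb =>
    homZero_coprodSet_of_mem_lOrth (h.subsetB hb) (fun a ha => h.hom_zero b hb a ha) ha
  have hzB : z ∈ rOrth B := h.triangB.rOrth.obj₃_mem hT haB hy
  have hS := (h.triangA.rOrth.inter h.triangB.rOrth).lOrth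
  have H (X : C) (hX : IsCompactObj X) : HomZero X z := by
    refine hS.triangClosure_le (fun W hW V hV => ?_) (h.generates.symm.subset hX) ⟨hz, hzB⟩
    exact hW.elim (fun hW => hV.1 hW) (fun hW => hV.2 hW)
  exact .ext hT ha (.zero (hG.generates z fun n => H _ (hG.compact.shift n)))

end Decomposition

end Paper

namespace Paper

variable {C : Type u} [Category.{v} C] [HasZeroObject C] [Preadditive C]
  [HasShift C ℤ] [∀ n : ℤ, (CategoryTheory.shiftFunctor C n).Additive] [Pretriangulated C]
  [HasCoproducts.{v} C]

/-- Let `T` be compactly generated with a single compact generator `G` such that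
`Hom(G, ΣⁿG) = 0` for all `n ≫ 0`, equipped with the generating sequence `𝒢ⁿ = {Σ⁻ⁿG}`
(so `M^𝒢_n = ⟨G⟩^{(-∞,-n]}` and `R^𝒢_n = ^⊥((M^𝒢_n)^⊥)`). For every admissible
subcategory `A` of `T^c`, the subcategory `Coprod(A) ∩ T^b_c` is a right admissible
subcategory of `T^b_c = T̄^c ∩ 𝒢^⊥`. In particular, for a semiorthogonal decomposition
`⟨A,B⟩` of `T^c` with `B` admissible, `⟨Coprod(A) ∩ T^b_c, Coprod(B) ∩ T^b_c⟩` is a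
semiorthogonal decomposition of `T^b_c`. -/
theorem statement_11 (G : C) (hG : IsSingleCompactGenerator G)
    (hvanish : ∃ N : ℕ, ∀ n : ℤ, (N : ℤ) ≤ n → ∀ f : G ⟶ G⟦n⟧, f = 0)
    (Tbc : Set C)
    (hTbc : Tbc =
      closureCompacts (fun n => lOrth (rOrth (genInt G (Set.Iic (-n))))) ∩
        ⋃ n : ℤ, rOrth (genInt G (Set.Iic (-n)))) :
    -- right admissibility of `Coprod(A) ∩ T^b_c` for every admissible `A ⊆ T^c`
    (∀ A : Set C,
      IsSOD (compacts (C := C)) (rOrth A ∩ compacts) A →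
      IsSOD (compacts (C := C)) A (lOrth A ∩ compacts) →
      IsSOD Tbc (rOrth (CoprodSet A ∩ Tbc) ∩ Tbc) (CoprodSet A ∩ Tbc)) ∧
    -- in particular, the induced semiorthogonal decomposition of `T^b_c`
    (∀ A B : Set C, IsSOD (compacts (C := C)) A B →
      IsSOD (compacts (C := C)) (rOrth B ∩ compacts) B →
      IsSOD (compacts (C := C)) B (lOrth B ∩ compacts) →
      IsSOD Tbc (CoprodSet A ∩ Tbc) (CoprodSet B ∩ Tbc)) := by
  obtain rfl : Tbc = tbc G := hTbc.trans (tbc_eq G).symm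
  have htbc := isTriangSub_tbc hG hvanish
  refine ⟨fun A hr hl => ?_, fun A B h hr hl => ?_⟩
  · have hA := (isTriangSub_coprodSet hl.triangA).inter htbc
    refine isSOD_of_exists_dist htbc (hA.rOrth.inter htbc) hA Set.inter_subset_right
      Set.inter_subset_right (fun b hb a ha => ha.1 hb) fun F hF => ?_
    obtain ⟨a, y, ha, hy, f, g, d, hT⟩ := exists_dist_of_admissible hG hvanish hr hl hF
    exact ⟨a, y, ha, ⟨fun w hw => bigClosure.homZero hw.1 fun _ hs => hy.1 hs, hy.2⟩, f, g, d, hT⟩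
  · refine isSOD_of_exists_dist htbc ((isTriangSub_coprodSet h.triangA).inter htbc)
      ((isTriangSub_coprodSet h.triangB).inter htbc) Set.inter_subset_right Set.inter_subset_right
      (fun b hb a ha => bigClosure.homZero hb.1 fun w hw =>
        homZero_coprodSet_of_mem_lOrth (h.subsetB hw) (fun _ hs => h.hom_zero w hw _ hs) ha.1)
      fun F hF => ?_
    obtain ⟨b, y, hb, hy, f, g, d, hT⟩ := exists_dist_of_admissible hG hvanish hr hl hF
    exact ⟨b, y, hb, ⟨h.mem_coprodSet hG hy.1, hy.2⟩, f, g, d, hT⟩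

end Paper
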